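/- Let n ≥ 1 and let c ≥ p ≥ 0 be integers. Then, in ℚ(q), the generating function Σ_T q^{n(T)}, summed over all tableaux T with at most c columns, exactly p of which are odd, and with all entries odd and lying between 1 and 2n−1, equals q^p · ([p+n−1 ¦ p]_{q^2} [c−p+n−1 ¦ c−p]_{q^2} / [c+n−1 ¦ c]_{q^2}) · Π_{i=1}^{n} (1/(1+q^{2(i−1)})) · Π_{1≤i<j≤n} ([c+i+j−2]_{q^2}/[i+j−2]_{q^2}) · ( (1+q^{c−2p}) Π_{i=1}^{n−1} (1+q^{c+2i}) + (1−q^{c−2p}) Π_{i=1}^{n−1} (1−q^{c+2i}) ). -/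

import Mathlib

open scoped Classical
open Finset

noncomputable section

/-- The indeterminate `q` of `ℚ(q)`. -/
def qq : RatFunc ℚ := RatFunc.X

/-- `[m]_q! = (1-q)(1-q²)⋯(1-q^m)`. -/
def qFact {F : Type} [Field F] (q : F) (m : ℕ) : F :=
  ∏ i ∈ Finset.range m, (1 - q ^ (i + 1))

/-- The q-binomial coefficient `[m ¦ k]_q` (zero for `k < 0`). -/
def qBinom {F : Type} [Field F] (q : F) (m : ℕ) (k : ℤ) : F :=
  if k < 0 then 0
  else (∏ i ∈ Finset.range k.toNat, (1 - q ^ ((m : ℤ) - (i : ℤ)))) / qFact q k.toNat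

/-- `T : Fin n → Fin c → ℕ` encodes a tableau with at most `n` rows and at most
`c` columns: `0` marks an empty cell; rows are left-justified, columns are
top-justified, rows weakly increase and columns strictly increase. -/
def IsTab (n c : ℕ) (T : Fin n → Fin c → ℕ) : Prop :=
  (∀ i : Fin n, ∀ j j' : Fin c, j ≤ j' → T i j' ≠ 0 → T i j ≠ 0) ∧
  (∀ i i' : Fin n, ∀ j : Fin c, i ≤ i' → T i' j ≠ 0 → T i j ≠ 0) ∧
  (∀ i : Fin n, ∀ j j' : Fin c, j ≤ j' → T i j' ≠ 0 → T i j ≤ T i j') ∧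
  (∀ i i' : Fin n, ∀ j : Fin c, i < i' → T i' j ≠ 0 → T i j < T i' j)

/-- The number of odd columns of (the shape of) the tableau `T`. -/
def oddColsTab (n c : ℕ) (T : Fin n → Fin c → ℕ) : ℕ :=
  (Finset.univ.filter (fun j : Fin c =>
    Odd ((Finset.univ.filter (fun i : Fin n => T i j ≠ 0)).card))).card

/-- `n(T)`: the sum of all entries of the tableau `T`. -/
def sumTab (n c : ℕ) (T : Fin n → Fin c → ℕ) : ℕ := ∑ i, ∑ j, T i j


/-- alternant with exponents `l j + (n-1-j)` -/
def altn {F : Type} [Field F] {n : ℕ} (x : Fin n → F) (l : Fin n → ℕ) : F :=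
  Matrix.det (Matrix.of fun i j : Fin n => x i ^ (l j + (n - 1 - (j : ℕ))))

theorem altn_succ {F : Type} [Field F] {n : ℕ} (x : Fin (n + 1) → F) (l : Fin (n + 1) → ℕ) :
    altn x l = ∑ k : Fin (n + 1), (-1) ^ (k : ℕ) * x k ^ (l 0 + n) *
      altn (fun i => x (k.succAbove i)) (fun j => l j.succ) := by
  unfold altn
  rw [Matrix.det_succ_column_zero]
  refine Finset.sum_congr rfl fun k _ => ?_
  congr 1
  congr 1
  ext i j
  simp only [Matrix.submatrix_apply, Matrix.of_apply, Fin.val_succ]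
  congr 2
  omega

theorem altn_zero_eq {F : Type} [Field F] {n : ℕ} (x : Fin n → F) :
    altn x (fun _ => 0) = ∏ i : Fin n, ∏ j ∈ Finset.Ioi i, (x i - x j) := by
  have h := Matrix.det_projVandermonde (fun _ : Fin n => (1 : F)) x
  simp only [one_mul] at h
  rw [← h]
  unfold altn
  congr 1
  ext i j
  simp only [Matrix.of_apply, Matrix.projVandermonde_apply, one_pow, one_mul, Fin.val_rev, zero_add]
  congr 1
  omega

theorem altn_zero_ne {F : Type} [Field F] {n : ℕ} (x : Fin n → F) (hx : Function.Injective x) :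
    altn x (fun _ => 0) ≠ 0 := by
  rw [altn_zero_eq]
  refine Finset.prod_ne_zero_iff.2 fun i _ => Finset.prod_ne_zero_iff.2 fun j hj => ?_
  rw [Finset.mem_Ioi] at hj
  exact sub_ne_zero.2 fun h => hj.ne (hx h)

theorem altn_zero_cons {F : Type} [Field F] {n : ℕ} (x : Fin (n + 1) → F) :
    altn x (fun _ => 0) = (∏ i : Fin n, (x 0 - x i.succ)) * altn (fun i => x i.succ) (fun _ => 0) := by
  rw [altn_zero_eq, altn_zero_eq, Fin.prod_univ_succ, Fin.prod_Ioi_zero]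
  congr 1
  refine Finset.prod_congr rfl fun i _ => ?_
  rw [Fin.prod_Ioi_succ]

theorem altn_zero_succAbove {F : Type} [Field F] {n : ℕ} (x : Fin (n + 1) → F) (k : Fin (n + 1)) :
    (-1) ^ (k : ℕ) * altn x (fun _ => 0) =
      (∏ i : Fin n, (x k - x (k.succAbove i))) *
        altn (fun i => x (k.succAbove i)) (fun _ => 0) := by
  have h := altn_zero_cons (fun i => x (k.cycleRange.symm i))
  simp only [Fin.cycleRange_symm_zero, Fin.cycleRange_symm_succ] at h
  rw [← h]
  unfold altn
  have := Matrix.det_permute k.cycleRange.symm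
    (Matrix.of fun i j : Fin (n+1) => x i ^ (0 + (n + 1 - 1 - (j : ℕ))))
  rw [Equiv.Perm.sign_symm, Fin.sign_cycleRange] at this
  push_cast at this
  exact this.symm

/-- Schur function as a ratio of alternants -/
def sch {F : Type} [Field F] {n : ℕ} (x : Fin n → F) (l : Fin n → ℕ) : F :=
  altn x l / altn x (fun _ => 0)

theorem sch_succ {F : Type} [Field F] {n : ℕ} (x : Fin (n + 1) → F) (hx : Function.Injective x)
    (l : Fin (n + 1) → ℕ) :
    sch x l = ∑ k : Fin (n + 1), x k ^ (l 0 + n) / (∏ i : Fin n, (x k - x (k.succAbove i))) *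
      sch (fun i => x (k.succAbove i)) (fun j => l j.succ) := by
  unfold sch
  rw [altn_succ, Finset.sum_div]
  refine Finset.sum_congr rfl fun k _ => ?_
  have h1 := altn_zero_ne x hx
  have h2 := altn_zero_ne (fun i => x (k.succAbove i)) (hx.comp Fin.succAbove_right_injective)
  have h3 := altn_zero_succAbove x k
  have h4 : (∏ i : Fin n, (x k - x (k.succAbove i))) ≠ 0 :=
    Finset.prod_ne_zero_iff.2 fun i _ => sub_ne_zero.2 fun h => Fin.succAbove_ne k i (hx h).symm
  have h5 : ((-1 : F) ^ (k : ℕ)) * (-1) ^ (k : ℕ) = 1 := by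
    rw [← mul_pow]; simp
  rw [div_mul_div_comm, ← h3, div_eq_div_iff h1 (by rw [h3]; exact mul_ne_zero h4 h2)]
  linear_combination (x k ^ (l 0 + n) * altn (fun i => x (k.succAbove i)) (fun j => l j.succ) * altn x (fun _ => 0)) * h5

theorem sch_zero {F : Type} [Field F] {n : ℕ} (x : Fin n → F) (hx : Function.Injective x) :
    sch x (fun _ => 0) = 1 := div_self (altn_zero_ne x hx)

/-! interpolation lemma -/

open Polynomial in
theorem interp_aux {F : Type} [Field F] (h2 : (2 : F) ≠ 0) (S : Finset F)
    (h1 : ∀ a ∈ S, a ≠ 1) (hm1 : ∀ a ∈ S, a ≠ -1) (P : F[X]) (hP : P.degree < (S.card + 2 : ℕ)) :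
    P.coeff (S.card + 1) = (∑ k ∈ S, P.eval k / ((k ^ 2 - 1) * ∏ i ∈ S.erase k, (k - i)))
      + P.eval 1 / (2 * ∏ i ∈ S, (1 - i)) + P.eval (-1) / (-2 * ∏ i ∈ S, (-1 - i)) := by
  have n1 : (1 : F) ∉ S := fun h => h1 1 h rfl
  have n2 : (-1 : F) ∉ S := fun h => hm1 _ h rfl
  have n3 : (1 : F) ≠ -1 := fun h => h2 (by linear_combination h)
  have n4 : (1 : F) ∉ insert (-1) S := by
    rw [Finset.mem_insert]; tauto
  have hc : (insert 1 (insert (-1) S) : Finset F).card = S.card + 2 := by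
    rw [Finset.card_insert_of_notMem n4, Finset.card_insert_of_notMem n2]
  have := Lagrange.coeff_eq_sum (s := insert 1 (insert (-1) S)) (v := fun a : F => a)
    (fun a _ b _ h => h) (P := P) (by rw [hc]; exact hP)
  rw [hc, Finset.sum_insert n4, Finset.sum_insert n2] at this
  rw [show S.card + 1 = S.card + 2 - 1 by omega, this]
  have e1 : (insert 1 (insert (-1) S)).erase (1 : F) = insert (-1) S := Finset.erase_insert n4
  have e2 : (insert 1 (insert (-1) S)).erase (-1 : F) = insert 1 S := by
    rw [Finset.insert_comm, Finset.erase_insert]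
    rw [Finset.mem_insert]; tauto
  rw [e1, e2, Finset.prod_insert n1, Finset.prod_insert n2]
  have : ∀ k ∈ S, ∏ j ∈ (insert 1 (insert (-1) S)).erase k, (k - j)
      = (k ^ 2 - 1) * ∏ i ∈ S.erase k, (k - i) := by
    intro k hk
    rw [Finset.erase_insert_of_ne (h1 k hk).symm, Finset.erase_insert_of_ne (hm1 k hk).symm,
      Finset.prod_insert, Finset.prod_insert]
    · ring
    · simp [n2]
    · simp [n1, n3]
  rw [Finset.sum_congr rfl fun k hk => by rw [this k hk]]
  norm_num
  ring

theorem interp_eval {F : Type} [Field F] (S : Finset F) (h0 : ∀ a ∈ S, a ≠ 0) (z : F)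
    (hz : z ^ 2 = 1) (h1 : ∀ a ∈ S, a ≠ z) :
    (∏ i ∈ S, (z - i⁻¹)) / (∏ i ∈ S, (z - i)) = (-z) ^ S.card * (∏ i ∈ S, i)⁻¹ := by
  rw [← Finset.prod_div_distrib, ← Finset.prod_inv_distrib, ← Finset.prod_const,
    ← Finset.prod_mul_distrib]
  refine Finset.prod_congr rfl fun i hi => ?_
  have := h0 i hi
  have h3 : z - i ≠ 0 := sub_ne_zero.2 (h1 i hi).symm
  field_simp
  linear_combination hz

open Polynomial in
theorem interp_main {F : Type} [Field F] (h2 : (2 : F) ≠ 0) (S : Finset F)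
    (h0 : ∀ a ∈ S, a ≠ 0)
    (h1 : ∀ a ∈ S, a ≠ 1) (hm1 : ∀ a ∈ S, a ≠ -1) (hS : Even S.card) :
    (∑ k ∈ S, ∏ i ∈ S.erase k, (k - i⁻¹) / (k - i)) = 1 - (∏ i ∈ S, i)⁻¹ ∧
    (∑ k ∈ S, k⁻¹ * ∏ i ∈ S.erase k, (k - i⁻¹) / (k - i)) = 0 := by
  set Q : F[X] := ∏ i ∈ S, (X - C (i⁻¹)) with hQ
  have hQm : Q.Monic := monic_prod_of_monic _ _ fun i _ => monic_X_sub_C _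
  have hQd : Q.natDegree = S.card := by
    rw [hQ, natDegree_prod_of_monic _ _ fun i _ => monic_X_sub_C _]; simp
  have hev : ∀ z, Q.eval z = ∏ i ∈ S, (z - i⁻¹) := by
    intro z; rw [hQ, eval_prod]; simp
  have e1 := interp_eval S h0 1 (by ring) h1
  have e2 := interp_eval S h0 (-1) (by ring) hm1
  rw [hS.neg_one_pow] at e1
  rw [neg_neg, one_pow] at e2
  have hk : ∀ k ∈ S, Q.eval k / ((k ^ 2 - 1) * ∏ i ∈ S.erase k, (k - i))
      = k⁻¹ * ∏ i ∈ S.erase k, (k - i⁻¹) / (k - i) := by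
    intro k hk
    rw [hev, ← Finset.mul_prod_erase S _ hk, Finset.prod_div_distrib]
    have a1 := h0 k hk
    have a2 : k ^ 2 - 1 ≠ 0 := by
      have : (k - 1) * (k + 1) ≠ 0 := mul_ne_zero (sub_ne_zero.2 (h1 k hk))
        (fun h => hm1 k hk (eq_neg_of_add_eq_zero_left h))
      intro h; apply this; linear_combination h
    have a3 : ∏ i ∈ S.erase k, (k - i) ≠ 0 := Finset.prod_ne_zero_iff.2 fun i hi =>
      sub_ne_zero.2 (Finset.ne_of_mem_erase hi).symm
    field_simp
  have hd : Q.degree < (S.card + 1 : ℕ) := by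
    rw [degree_eq_natDegree hQm.ne_zero, hQd]; exact_mod_cast Nat.lt_succ_self _
  constructor
  · have := interp_aux h2 S h1 hm1 (X * Q) (by
      rw [degree_mul, degree_X, degree_eq_natDegree hQm.ne_zero, hQd]
      norm_cast; omega)
    rw [coeff_X_mul, ← hQd, hQm.coeff_natDegree] at this
    simp only [eval_mul, eval_X] at this
    rw [hev 1, hev (-1)] at this
    have e3 : (∑ k ∈ S, ∏ i ∈ S.erase k, (k - i⁻¹) / (k - i)) =
        ∑ k ∈ S, k * eval k Q / ((k ^ 2 - 1) * ∏ i ∈ S.erase k, (k - i)) := by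
      refine Finset.sum_congr rfl fun k hk' => ?_
      rw [mul_div_assoc, hk k hk', ← mul_assoc, mul_inv_cancel₀ (h0 k hk'), one_mul]
    rw [e3]
    have e4 : (1 : F) * (∏ i ∈ S, (1 - i⁻¹)) / (2 * ∏ i ∈ S, (1 - i)) = 1/2 * (∏ i ∈ S, i)⁻¹ := by
      rw [mul_div_mul_comm, e1]; ring
    have e5 : (-1 : F) * (∏ i ∈ S, (-1 - i⁻¹)) / (-2 * ∏ i ∈ S, (-1 - i)) = 1/2 * (∏ i ∈ S, i)⁻¹ := by
      rw [mul_div_mul_comm, e2, neg_div_neg_eq]; ring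
    rw [e4, e5] at this
    have h22 : (1 / 2 : F) + 1 / 2 = 1 := by field_simp; norm_num
    linear_combination -this + (∏ i ∈ S, i)⁻¹ * (-h22)
  · have := interp_aux h2 S h1 hm1 Q (hd.trans (by exact_mod_cast Nat.lt_succ_self _))
    rw [coeff_eq_zero_of_degree_lt hd, hev 1, hev (-1), Finset.sum_congr rfl hk] at this
    have e4 : (∏ i ∈ S, (1 - i⁻¹)) / (2 * ∏ i ∈ S, (1 - i)) = 1/2 * (∏ i ∈ S, i)⁻¹ := by
      rw [← one_mul (∏ i ∈ S, (1 - i⁻¹)), mul_div_mul_comm, e1]; ring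
    have e5 : (∏ i ∈ S, (-1 - i⁻¹)) / (-2 * ∏ i ∈ S, (-1 - i)) = -(1/2) * (∏ i ∈ S, i)⁻¹ := by
      rw [← one_mul (∏ i ∈ S, (-1 - i⁻¹)), mul_div_mul_comm, e2, div_neg]; ring
    rw [e4, e5] at this
    linear_combination -this

/-- product over unordered pairs -/
def pprod {F ι : Type} [Field F] [LinearOrder ι] (A : Finset ι) (w : ι → ι → F) : F :=
  ∏ j ∈ A, ∏ i ∈ A.filter (fun i => i < j), w i j

theorem pprod_insert {F ι : Type} [Field F] [LinearOrder ι] (B : Finset ι) (w : ι → ι → F)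
    (hw : ∀ i j, w i j = w j i) (k : ι) (hk : k ∉ B) :
    pprod (insert k B) w = pprod B w * ∏ i ∈ B, w i k := by
  unfold pprod
  rw [Finset.prod_insert hk, Finset.filter_insert, if_neg (lt_irrefl k)]
  have h1 : ∀ j ∈ B, ∏ i ∈ (insert k B).filter (fun i => i < j), w i j =
      (∏ i ∈ B.filter (fun i => i < j), w i j) * (if k < j then w j k else 1) := by
    intro j hj
    rw [Finset.filter_insert]
    split_ifs with h
    · rw [Finset.prod_insert (by simp [hk]), mul_comm, hw k j]
    · rw [mul_one]
  rw [Finset.prod_congr rfl h1, Finset.prod_mul_distrib, ← Finset.prod_filter, mul_comm, mul_assoc]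
  congr 1
  rw [mul_comm, ← Finset.prod_filter_mul_prod_filter_not B (fun i => i < k)]
  congr 1
  refine Finset.prod_congr ?_ fun _ _ => rfl
  ext i
  simp only [Finset.mem_filter, not_lt]
  constructor
  · rintro ⟨h, h'⟩; exact ⟨h, h'.le⟩
  · rintro ⟨h, h'⟩; exact ⟨h, lt_of_le_of_ne h' (fun e => hk (e ▸ h))⟩

theorem pprod_congr {F ι : Type} [Field F] [LinearOrder ι] (A : Finset ι) (w w' : ι → ι → F)
    (h : ∀ i ∈ A, ∀ j ∈ A, i < j → w i j = w' i j) : pprod A w = pprod A w' := by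
  unfold pprod
  refine Finset.prod_congr rfl fun j hj => Finset.prod_congr rfl fun i hi => ?_
  rw [Finset.mem_filter] at hi
  exact h i hi.1 j hj hi.2

/-- `x` with entries in `S` inverted -/
def yv {F ι : Type} [Field F] [LinearOrder ι] (x : ι → F) (S : Finset ι) (i : ι) : F :=
  if i ∈ S then (x i)⁻¹ else x i

/-- complete homogeneous function -/
def hh {F ι : Type} [Field F] [LinearOrder ι] (A : Finset ι) (y : ι → F) (p : ℤ) : F :=
  ∑ k ∈ A, y k ^ ((A.card : ℤ) - 1 + p) / ∏ i ∈ A.erase k, (y k - y i)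

theorem hh_erase {F ι : Type} [Field F] [LinearOrder ι] (A : Finset ι) (y : ι → F) (p : ℤ)
    (hy : Function.Injective y) (h0 : ∀ i, y i ≠ 0) (k : ι) (hk : k ∈ A) :
    hh (A.erase k) y p = hh A y p - y k * hh A y (p - 1) := by
  unfold hh
  rw [Finset.mul_sum, ← Finset.sum_sub_distrib, ← Finset.add_sum_erase A _ hk]
  have e : ∀ i : ι, y i ^ ((A.card : ℤ) - 1 + p) = y i * y i ^ ((A.card : ℤ) - 1 + (p - 1)) := by
    intro i
    rw [← zpow_one_add₀ (h0 i)]; congr 1; ring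
  have e0 : y k ^ ((A.card : ℤ) - 1 + p) / ∏ i ∈ A.erase k, (y k - y i)
      - y k * (y k ^ ((A.card : ℤ) - 1 + (p - 1)) / ∏ i ∈ A.erase k, (y k - y i)) = 0 := by
    rw [e k]; ring
  rw [e0, zero_add]
  refine Finset.sum_congr rfl fun i hi => ?_
  have hik : i ≠ k := Finset.ne_of_mem_erase hi
  have hki : k ∈ A.erase i := Finset.mem_erase.2 ⟨hik.symm, hk⟩
  rw [← Finset.mul_prod_erase (A.erase i) _ hki, Finset.erase_right_comm, e i,
    Finset.card_erase_of_mem hk]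
  have hc : ((A.card - 1 : ℕ) : ℤ) - 1 + p = (A.card : ℤ) - 1 + (p - 1) := by
    have : 1 ≤ A.card := Finset.card_pos.2 ⟨k, hk⟩
    push_cast [this]; ring
  rw [hc]
  have n1 : y i - y k ≠ 0 := sub_ne_zero.2 fun h => hik (hy h)
  have n2 : ∏ j ∈ (A.erase i).erase k, (y i - y j) ≠ 0 := Finset.prod_ne_zero_iff.2 fun j hj =>
    sub_ne_zero.2 fun h => (Finset.ne_of_mem_erase (Finset.mem_of_mem_erase hj)) (hy h).symm
  field_simp

/-- genericity assumption -/
structure Gen {F ι : Type} [Field F] (x : ι → F) : Prop where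
  two : (2 : F) ≠ 0
  inj : Function.Injective x
  ne0 : ∀ i, x i ≠ 0
  ne1 : ∀ i j, x i * x j ≠ 1

section
variable {F ι : Type} [Field F] [LinearOrder ι] {x : ι → F}

theorem Gen.yv_ne0 (hx : Gen x) (S : Finset ι) (i : ι) : yv x S i ≠ 0 := by
  unfold yv; split_ifs
  · exact inv_ne_zero (hx.ne0 i)
  · exact hx.ne0 i

theorem Gen.yv_inj (hx : Gen x) (S : Finset ι) : Function.Injective (yv x S) := by
  intro i j h
  have hi := hx.ne0 i
  have hj := hx.ne0 j
  have h1 := hx.ne1 i j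
  unfold yv at h
  split_ifs at h
  · exact hx.inj (inv_injective h)
  · exact absurd (by rw [← h, mul_inv_cancel₀ hi]) h1
  · exact absurd (by rw [h, inv_mul_cancel₀ hj]) h1
  · exact hx.inj h

theorem Gen.yv_mul (hx : Gen x) (S : Finset ι) (i j : ι) (hij : i ≠ j) :
    1 - yv x S i * yv x S j ≠ 0 := by
  have hi := hx.ne0 i
  have hj := hx.ne0 j
  have h1 := hx.ne1 i j
  have hn : x i ≠ x j := fun h => hij (hx.inj h)
  rw [sub_ne_zero]
  intro h
  unfold yv at h
  split_ifs at h
  · apply h1; field_simp at h; exact h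
  · apply hn; field_simp at h; exact h
  · apply hn; field_simp at h; exact h.symm
  · exact h1 h.symm

/-- weight of a subset -/
def wgt (A : Finset ι) (x : ι → F) (S : Finset ι) (c : ℤ) : F :=
  (∏ i ∈ S, x i) ^ c * pprod A (fun i j => (1 - yv x S i * yv x S j)⁻¹)

/-- the parity restricted subset sum -/
def EE (A : Finset ι) (x : ι → F) (b : ℕ) (c p : ℤ) : F :=
  ∑ S ∈ A.powerset.filter (fun S => S.card % 2 = b), wgt A x S c * hh A (yv x S) p

theorem wgt_insert (A : Finset ι) (S : Finset ι) (c : ℤ) (k : ι) (hk : k ∈ A) :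
    wgt A x S c = (∏ i ∈ S, x i) ^ c * (pprod (A.erase k) (fun i j => (1 - yv x S i * yv x S j)⁻¹) *
      ∏ i ∈ A.erase k, (1 - yv x S i * yv x S k)⁻¹) := by
  unfold wgt
  rw [← pprod_insert _ _ (fun i j => by rw [mul_comm]) k (by simp), Finset.insert_erase hk]

theorem yv_insert_ne (S : Finset ι) (k i : ι) (h : i ≠ k) : yv x (insert k S) i = yv x S i := by
  unfold yv; simp [h]

theorem pprod_yv_insert (B : Finset ι) (S : Finset ι) (k : ι) (hk : k ∉ B) :
    pprod B (fun i j => (1 - yv x (insert k S) i * yv x (insert k S) j)⁻¹) =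
    pprod B (fun i j => (1 - yv x S i * yv x S j)⁻¹) := by
  refine pprod_congr _ _ _ fun i hi j hj _ => ?_
  rw [yv_insert_ne S k i (fun e => hk (e ▸ hi)), yv_insert_ne S k j (fun e => hk (e ▸ hj))]

theorem tog_aux (hx : Gen x) (A S : Finset ι) (c p : ℤ) (k : ι) (hk : k ∈ A) (hkS : k ∉ S) :
    wgt A x S c * (yv x S k ^ ((A.card : ℤ) - 1 + p) / ∏ i ∈ A.erase k, (yv x S k - yv x S i)) =
    wgt A x (insert k S) c * (yv x (insert k S) k ^ ((A.card : ℤ) - 1 + (c - p)) /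
      ∏ i ∈ A.erase k, (yv x (insert k S) k - yv x (insert k S) i)) := by
  have ha := hx.ne0 k
  rw [wgt_insert A S c k hk, wgt_insert A (insert k S) c k hk, pprod_yv_insert _ _ _ (by simp),
    Finset.prod_insert hkS]
  have e1 : yv x S k = x k := by simp [yv, hkS]
  have e2 : yv x (insert k S) k = (x k)⁻¹ := by simp [yv]
  rw [e1, e2]
  have e3 : ∏ i ∈ A.erase k, (1 - yv x (insert k S) i * (x k)⁻¹)⁻¹ =
      ∏ i ∈ A.erase k, (1 - yv x S i * (x k)⁻¹)⁻¹ :=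
    Finset.prod_congr rfl fun i hi => by rw [yv_insert_ne S k i (Finset.ne_of_mem_erase hi)]
  have e4 : ∏ i ∈ A.erase k, ((x k)⁻¹ - yv x (insert k S) i) =
      ∏ i ∈ A.erase k, ((x k)⁻¹ - yv x S i) :=
    Finset.prod_congr rfl fun i hi => by rw [yv_insert_ne S k i (Finset.ne_of_mem_erase hi)]
  rw [e3, e4, mul_zpow]
  have key : (∏ i ∈ A.erase k, (1 - yv x S i * x k)⁻¹) / ∏ i ∈ A.erase k, (x k - yv x S i) =
      (∏ i ∈ A.erase k, (1 - yv x S i * (x k)⁻¹)⁻¹) / (∏ i ∈ A.erase k, ((x k)⁻¹ - yv x S i))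
        / (x k ^ 2) ^ (A.card - 1) := by
    rw [← Finset.card_erase_of_mem hk, ← Finset.prod_const, ← Finset.prod_div_distrib,
      ← Finset.prod_div_distrib, ← Finset.prod_div_distrib]
    refine Finset.prod_congr rfl fun i hi => ?_
    have hik := Finset.ne_of_mem_erase hi
    have n1 := hx.yv_mul S i k hik
    have n2 : yv x S k - yv x S i ≠ 0 := sub_ne_zero.2 fun h => hik (hx.yv_inj S h).symm
    rw [e1] at n1 n2
    have n3 : 1 - yv x S i * (x k)⁻¹ ≠ 0 := by
      intro h; apply n2; field_simp at h; linear_combination h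
    have n4 : (x k)⁻¹ - yv x S i ≠ 0 := by
      intro h; apply n1; field_simp at h; linear_combination h
    rw [div_div, ← one_div, ← one_div, div_div, div_div, div_eq_div_iff (mul_ne_zero n1 n2)
      (mul_ne_zero n3 (mul_ne_zero n4 (pow_ne_zero _ ha)))]
    field_simp
  have e5 : x k ^ ((A.card : ℤ) - 1 + p) =
      x k ^ c * (x k)⁻¹ ^ ((A.card : ℤ) - 1 + (c - p)) * (x k ^ 2) ^ (A.card - 1) := by
    rw [inv_zpow', ← zpow_add₀ ha, ← pow_mul, ← zpow_natCast, ← zpow_add₀ ha]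
    congr 1
    have : 1 ≤ A.card := Finset.card_pos.2 ⟨k, hk⟩
    push_cast [this]; ring
  have hne : (x k ^ 2) ^ (A.card - 1) ≠ 0 := pow_ne_zero _ (pow_ne_zero _ ha)
  rw [e5]
  generalize (x k ^ 2) ^ (A.card - 1) = d at key hne ⊢
  have key2 : (∏ i ∈ A.erase k, (1 - yv x S i * (x k)⁻¹)⁻¹) / (∏ i ∈ A.erase k, ((x k)⁻¹ - yv x S i))
      = (∏ i ∈ A.erase k, (1 - yv x S i * x k)⁻¹) / (∏ i ∈ A.erase k, (x k - yv x S i)) * d := by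
    rw [key, div_mul_cancel₀ _ hne]
  simp only [div_eq_mul_inv] at key2 ⊢
  linear_combination (-(x k ^ c * (∏ i ∈ S, x i) ^ c *
    pprod (A.erase k) (fun i j => (1 - yv x S i * yv x S j)⁻¹) *
    (x k)⁻¹ ^ ((A.card : ℤ) - 1 + (c - p)))) * key2

/-- toggling -/
def tog (k : ι) (S : Finset ι) : Finset ι := if k ∈ S then S.erase k else insert k S

theorem tog_tog (k : ι) (S : Finset ι) : tog k (tog k S) = S := by
  unfold tog
  by_cases h : k ∈ S
  · simp [h, Finset.insert_erase h]
  · simp [h]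

theorem tog_subset (k : ι) (S A : Finset ι) (hk : k ∈ A) (h : S ⊆ A) : tog k S ⊆ A := by
  unfold tog
  split_ifs
  · exact (Finset.erase_subset _ _).trans h
  · exact Finset.insert_subset hk h

theorem tog_card (k : ι) (S : Finset ι) : (tog k S).card % 2 = 1 - S.card % 2 := by
  unfold tog
  split_ifs with h
  · have := Finset.card_erase_add_one h
    omega
  · rw [Finset.card_insert_of_notMem h]; omega

theorem tog_term (hx : Gen x) (A S : Finset ι) (c p : ℤ) (k : ι) (hk : k ∈ A) :
    wgt A x S c * (yv x S k ^ ((A.card : ℤ) - 1 + p) / ∏ i ∈ A.erase k, (yv x S k - yv x S i)) =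
    wgt A x (tog k S) c * (yv x (tog k S) k ^ ((A.card : ℤ) - 1 + (c - p)) /
      ∏ i ∈ A.erase k, (yv x (tog k S) k - yv x (tog k S) i)) := by
  by_cases h : k ∈ S
  · have := tog_aux hx A (S.erase k) c (c - p) k hk (by simp)
    rw [Finset.insert_erase h, sub_sub_cancel] at this
    rw [← this, tog, if_pos h]
  · rw [tog_aux hx A S c p k hk h, tog, if_neg h]

theorem EE_symm (hx : Gen x) (A : Finset ι) (c p : ℤ) : EE A x 1 c p = EE A x 0 c (c - p) := by
  unfold EE hh
  simp only [Finset.mul_sum]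
  rw [Finset.sum_comm, Finset.sum_comm (s := A.powerset.filter (fun S => S.card % 2 = 0))]
  refine Finset.sum_congr rfl fun k hk => ?_
  refine Finset.sum_nbij' (tog k) (tog k) ?_ ?_ ?_ ?_ ?_
  · intro S hS
    simp only [Finset.mem_filter, Finset.mem_powerset] at hS ⊢
    exact ⟨tog_subset k S A hk hS.1, by rw [tog_card]; omega⟩
  · intro S hS
    simp only [Finset.mem_filter, Finset.mem_powerset] at hS ⊢
    exact ⟨tog_subset k S A hk hS.1, by rw [tog_card]; omega⟩
  · intro S _; exact tog_tog k S
  · intro S _; exact tog_tog k S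
  · intro S _; exact tog_term hx A S c p k hk

theorem interp_idx (hx : Gen x) (S : Finset ι) (hS : S.card % 2 = 0) :
    (∑ k ∈ S, ∏ i ∈ S.erase k, (x k - (x i)⁻¹) / (x k - x i)) = 1 - (∏ i ∈ S, x i)⁻¹ ∧
    (∑ k ∈ S, (x k)⁻¹ * ∏ i ∈ S.erase k, (x k - (x i)⁻¹) / (x k - x i)) = 0 := by
  have hinj : Set.InjOn x S := hx.inj.injOn
  have h := interp_main hx.two (S.image x)
    (by intro a ha; obtain ⟨i, _, rfl⟩ := Finset.mem_image.1 ha; exact hx.ne0 i)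
    (by
      intro a ha; obtain ⟨i, _, rfl⟩ := Finset.mem_image.1 ha
      intro h; exact hx.ne1 i i (by rw [h]; ring))
    (by
      intro a ha; obtain ⟨i, _, rfl⟩ := Finset.mem_image.1 ha
      intro h; exact hx.ne1 i i (by rw [h]; ring))
    (by rw [Finset.card_image_of_injective _ hx.inj, Nat.even_iff]; exact hS)
  rw [Finset.sum_image hinj, Finset.sum_image hinj, Finset.prod_image hinj] at h
  have e : ∀ k, ∏ i ∈ (S.image x).erase (x k), (x k - i⁻¹) / (x k - i) =
      ∏ i ∈ S.erase k, (x k - (x i)⁻¹) / (x k - x i) := by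
    intro k
    rw [← Finset.image_erase hx.inj, Finset.prod_image hx.inj.injOn]
  simp only [e] at h
  exact h

theorem EE_rec (hx : Gen x) (A : Finset ι) (c p : ℤ) :
    EE A x 0 c p - EE A x 0 (c - 1) p =
    ∑ k ∈ A, x k ^ (c + A.card - 1) / (∏ i ∈ A.erase k, (x k - x i)) *
      EE (A.erase k) x 1 c p := by
  have hL : EE A x 0 c p - EE A x 0 (c - 1) p =
      ∑ S ∈ A.powerset.filter (fun S => S.card % 2 = 0), ∑ k ∈ S,
        wgt A x S c * (∏ i ∈ S.erase k, (x k - (x i)⁻¹) / (x k - x i)) *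
          hh (A.erase k) (yv x S) p := by
    unfold EE
    rw [← Finset.sum_sub_distrib]
    refine Finset.sum_congr rfl fun S hS => ?_
    rw [Finset.mem_filter, Finset.mem_powerset] at hS
    obtain ⟨i1, i2⟩ := interp_idx hx S hS.2
    have hP : (∏ i ∈ S, x i) ≠ 0 := Finset.prod_ne_zero_iff.2 fun i _ => hx.ne0 i
    have hw : wgt A x S (c - 1) = wgt A x S c * (∏ i ∈ S, x i)⁻¹ := by
      unfold wgt; rw [zpow_sub_one₀ hP]; ring
    have : ∀ k ∈ S, wgt A x S c * (∏ i ∈ S.erase k, (x k - (x i)⁻¹) / (x k - x i)) *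
          hh (A.erase k) (yv x S) p =
        wgt A x S c * hh A (yv x S) p * (∏ i ∈ S.erase k, (x k - (x i)⁻¹) / (x k - x i)) -
        wgt A x S c * hh A (yv x S) (p - 1) *
          ((x k)⁻¹ * (∏ i ∈ S.erase k, (x k - (x i)⁻¹) / (x k - x i))) := by
      intro k hk
      rw [hh_erase A _ p (hx.yv_inj S) (hx.yv_ne0 S) k (hS.1 hk)]
      have : yv x S k = (x k)⁻¹ := by simp [yv, hk]
      rw [this]; ring
    rw [Finset.sum_congr rfl this, Finset.sum_sub_distrib, ← Finset.mul_sum, ← Finset.mul_sum,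
      i1, i2, hw]
    ring
  rw [hL]
  unfold EE
  simp only [Finset.mul_sum]
  rw [Finset.sum_comm' (t' := A)
    (s' := fun k => (A.powerset.filter (fun S => S.card % 2 = 0)).filter (fun S => k ∈ S))]
  swap
  · intro S k
    simp only [Finset.mem_filter, Finset.mem_powerset]
    constructor
    · rintro ⟨⟨a, b⟩, d⟩; exact ⟨⟨⟨a, b⟩, d⟩, a d⟩
    · rintro ⟨⟨⟨a, b⟩, d⟩, _⟩; exact ⟨⟨a, b⟩, d⟩
  refine Finset.sum_congr rfl fun k hk => ?_
  refine Finset.sum_nbij' (fun S => S.erase k) (fun S => insert k S) ?_ ?_ ?_ ?_ ?_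
  · intro S hS
    simp only [Finset.mem_filter, Finset.mem_powerset] at hS ⊢
    refine ⟨Finset.erase_subset_erase k hS.1.1, ?_⟩
    have := Finset.card_erase_add_one hS.2
    omega
  · intro S hS
    simp only [Finset.mem_filter, Finset.mem_powerset] at hS ⊢
    have hkS : k ∉ S := fun h => by simpa using hS.1 h
    refine ⟨⟨Finset.insert_subset hk (hS.1.trans (Finset.erase_subset _ _)), ?_⟩,
      Finset.mem_insert_self _ _⟩
    rw [Finset.card_insert_of_notMem hkS]; omega
  · intro S hS
    simp only [Finset.mem_filter] at hS
    exact Finset.insert_erase hS.2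
  · intro S hS
    simp only [Finset.mem_filter, Finset.mem_powerset] at hS ⊢
    have hkS : k ∉ S := fun h => by simpa using hS.1 h
    exact Finset.erase_insert hkS
  · intro S hS
    simp only [Finset.mem_filter, Finset.mem_powerset] at hS
    obtain ⟨⟨hSA, hSe⟩, hkS⟩ := hS
    obtain ⟨S', hS'⟩ : ∃ S', S' = S.erase k := ⟨_, rfl⟩
    have hSi : S = insert k S' := by rw [hS', Finset.insert_erase hkS]
    have hkS' : k ∉ S' := by rw [hS']; simp
    have hsub : S' ⊆ A.erase k := by rw [hS']; exact Finset.erase_subset_erase k hSA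
    rw [← hS', hSi, wgt_insert A _ c k hk, pprod_yv_insert _ _ _ (by simp), Finset.prod_insert hkS']
    have e1 : hh (A.erase k) (yv x (insert k S')) p = hh (A.erase k) (yv x S') p := by
      unfold hh
      refine Finset.sum_congr rfl fun i hi => ?_
      rw [yv_insert_ne S' k i (Finset.ne_of_mem_erase hi)]
      congr 1
      refine Finset.prod_congr rfl fun j hj => ?_
      rw [yv_insert_ne S' k j (Finset.ne_of_mem_erase (Finset.mem_of_mem_erase hj))]
    rw [e1]
    have e2 : yv x (insert k S') k = (x k)⁻¹ := by simp [yv]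
    have e3 : (∏ i ∈ A.erase k, (1 - yv x (insert k S') i * yv x (insert k S') k)⁻¹) *
        (∏ i ∈ S', (x k - (x i)⁻¹) / (x k - x i)) = x k ^ (A.card - 1) /
          ∏ i ∈ A.erase k, (x k - x i) := by
      have h1 : ∏ i ∈ S', (x k - (x i)⁻¹) / (x k - x i) =
          ∏ i ∈ A.erase k, (x k - yv x S' i) / (x k - x i) := by
        have : ∏ i ∈ S', (x k - (x i)⁻¹) / (x k - x i) =
            ∏ i ∈ S', (x k - yv x S' i) / (x k - x i) :=
          Finset.prod_congr rfl fun i hi => by simp [yv, hi]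
        rw [this]
        refine Finset.prod_subset hsub fun i hi hi' => ?_
        have : yv x S' i = x i := by simp [yv, hi']
        rw [this]
        exact div_self (sub_ne_zero.2 fun h => Finset.ne_of_mem_erase hi (hx.inj h).symm)
      rw [h1, ← Finset.card_erase_of_mem hk, ← Finset.prod_const, ← Finset.prod_div_distrib,
        ← Finset.prod_mul_distrib]
      refine Finset.prod_congr rfl fun i hi => ?_
      have hik := Finset.ne_of_mem_erase hi
      rw [yv_insert_ne S' k i hik, e2]
      have n1 := hx.ne0 k
      have n2 : x k - x i ≠ 0 := sub_ne_zero.2 fun h => hik (hx.inj h).symm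
      have n3 : yv x S' k - yv x S' i ≠ 0 := sub_ne_zero.2 fun h => hik (hx.yv_inj S' h).symm
      have : yv x S' k = x k := by simp [yv, hkS']
      rw [this] at n3
      have e : 1 - yv x S' i * (x k)⁻¹ = (x k - yv x S' i) / x k := by field_simp
      rw [e]
      field_simp
    have e4 : x k ^ (c + A.card - 1) = x k ^ c * x k ^ (A.card - 1) := by
      have : 1 ≤ A.card := Finset.card_pos.2 ⟨k, hk⟩
      rw [← zpow_natCast, ← zpow_add₀ (hx.ne0 k)]
      congr 1; push_cast [this]; ring
    rw [mul_zpow, e4]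
    unfold wgt
    simp only [div_eq_mul_inv] at e3 ⊢
    linear_combination (x k ^ c * (∏ i ∈ S', x i) ^ c *
      pprod (A.erase k) (fun i j => (1 - yv x S' i * yv x S' j)⁻¹) *
      hh (A.erase k) (yv x S') p) * e3

end

/-- alternating sum -/
def altS {n : ℕ} (l : Fin n → ℕ) : ℤ := ∑ i : Fin n, (-1) ^ (i : ℕ) * (l i : ℤ)

theorem altS_succ {n : ℕ} (l : Fin (n + 1) → ℕ) :
    altS l = l 0 - altS (fun i => l i.succ) := by
  unfold altS
  rw [Fin.sum_univ_succ]
  simp only [Fin.val_zero, pow_zero, one_mul, Fin.val_succ, pow_succ, mul_neg, mul_one, neg_mul,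
    Finset.sum_neg_distrib]
  ring

theorem altS_bound (n : ℕ) : ∀ (l : Fin n → ℕ) (a : ℕ), Antitone l → (∀ i, l i ≤ a) →
    0 ≤ altS l ∧ altS l ≤ a := by
  induction n with
  | zero => intro l a _ _; simp [altS]
  | succ n ih =>
    intro l a hl ha
    have := ih (fun i => l i.succ) (l 0) (fun i j h => hl (Fin.succ_le_succ_iff.2 h))
      (fun i => hl (Fin.zero_le _))
    have h0 := ha 0
    rw [altS_succ]
    constructor <;> omega

/-- index set of partitions -/
def PS (n C : ℕ) (p : ℤ) : Finset (Fin n → ℕ) :=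
  (Fintype.piFinset fun _ : Fin n => Finset.range C).filter (fun l => Antitone l ∧ altS l = p)

/-- sum of Schur functions -/
def GG {F : Type} [Field F] (n C : ℕ) (p : ℤ) (x : Fin n → F) : F := ∑ l ∈ PS n C p, sch x l

theorem mem_PS (n C : ℕ) (p : ℤ) (l : Fin n → ℕ) :
    l ∈ PS n C p ↔ (∀ i, l i < C) ∧ Antitone l ∧ altS l = p := by
  simp [PS, Fintype.mem_piFinset]

theorem GG_rec {F : Type} [Field F] (n c : ℕ) (p : ℤ) (x : Fin (n + 1) → F)
    (hx : Function.Injective x) :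
    GG (n + 1) (c + 1) p x = GG (n + 1) c p x +
      ∑ k : Fin (n + 1), x k ^ (c + n) / (∏ i : Fin n, (x k - x (k.succAbove i))) *
        GG n (c + 1) (c - p) (fun i => x (k.succAbove i)) := by
  unfold GG
  rw [← Finset.sum_filter_add_sum_filter_not (PS (n + 1) (c + 1) p) (fun l => l 0 < c)]
  congr 1
  · refine Finset.sum_congr ?_ fun _ _ => rfl
    ext l
    simp only [Finset.mem_filter, mem_PS]
    constructor
    · rintro ⟨⟨h1, h2, h3⟩, h4⟩
      exact ⟨fun i => lt_of_le_of_lt (h2 (Fin.zero_le i)) h4, h2, h3⟩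
    · rintro ⟨h1, h2, h3⟩
      exact ⟨⟨fun i => Nat.lt_succ_of_lt (h1 i), h2, h3⟩, h1 0⟩
  · simp only [Finset.mul_sum]
    rw [Finset.sum_comm]
    refine Finset.sum_nbij' (fun l i => l i.succ) (fun m => Fin.cons c m) ?_ ?_ ?_ ?_ ?_
    · intro l hl
      simp only [Finset.mem_filter, mem_PS] at hl ⊢
      obtain ⟨⟨h1, h2, h3⟩, h4⟩ := hl
      refine ⟨fun i => h1 _, fun i j h => h2 (Fin.succ_le_succ_iff.2 h), ?_⟩
      rw [altS_succ] at h3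
      have := h1 0
      have : l 0 = c := by omega
      rw [this] at h3
      linarith
    · intro m hm
      simp only [Finset.mem_filter, mem_PS] at hm ⊢
      obtain ⟨h1, h2, h3⟩ := hm
      refine ⟨⟨?_, ?_, ?_⟩, by simp⟩
      · intro i
        refine Fin.cases ?_ (fun i => ?_) i
        · simp
        · simpa using h1 i
      · intro i j
        refine Fin.cases ?_ (fun i => ?_) i
        · intro _
          refine Fin.cases ?_ (fun j => ?_) j
          · simp
          · simpa using Nat.lt_succ_iff.1 (h1 j)
        · refine Fin.cases ?_ (fun j => ?_) j
          · intro h; exact absurd h (by simp [Fin.le_def])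
          · intro h; simpa using h2 (Fin.succ_le_succ_iff.1 h)
      · rw [altS_succ]; simp [h3]
    · intro l hl
      simp only [Finset.mem_filter, mem_PS] at hl
      have h1 := hl.1.1 0
      have : l 0 = c := by omega
      funext i
      refine Fin.cases ?_ (fun i => ?_) i
      · simp [this]
      · simp
    · intro m _; simp
    · intro l hl
      simp only [Finset.mem_filter, mem_PS] at hl
      have h1 := hl.1.1 0
      have : l 0 = c := by omega
      rw [sch_succ x hx, this]

open Polynomial in
theorem hh_neg_one {F ι : Type} [Field F] [LinearOrder ι] (A : Finset ι) (y : ι → F)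
    (hy : Function.Injective y) (hA : 2 ≤ A.card) : hh A y (-1) = 0 := by
  have := Lagrange.coeff_eq_sum (s := A) (v := y) (hy.injOn) (P := (X : F[X]) ^ (A.card - 2))
    (by rw [degree_X_pow]; exact_mod_cast (by omega : A.card - 2 < A.card))
  rw [coeff_X_pow, if_neg (by omega)] at this
  rw [this]
  unfold hh
  refine Finset.sum_congr rfl fun k _ => ?_
  rw [eval_pow, eval_X, ← zpow_natCast]
  congr 2
  omega

section
variable {F ι : Type} [Field F] [LinearOrder ι] {x : ι → F}

theorem EE_top (hx : Gen x) (A : Finset ι) (hA : 2 ≤ A.card) (c : ℤ) :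
    EE A x 0 c (c + 1) = 0 := by
  have := EE_symm hx A c (-1)
  rw [sub_neg_eq_add] at this
  rw [← this]
  unfold EE
  refine Finset.sum_eq_zero fun S _ => ?_
  rw [hh_neg_one A _ (hx.yv_inj S) hA, mul_zero]

theorem EE_single (k : ι) (c p : ℤ) :
    EE {k} x 0 c p = x k ^ p := by
  unfold EE
  have : ({k} : Finset ι).powerset.filter (fun S => S.card % 2 = 0) = {∅} := by
    ext S
    simp only [Finset.mem_filter, Finset.mem_powerset, Finset.mem_singleton,
      Finset.subset_singleton_iff]
    constructor
    · rintro ⟨h | h, h'⟩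
      · exact h
      · rw [h] at h'; simp at h'
    · intro h; subst h; simp
  rw [this, Finset.sum_singleton]
  unfold wgt hh pprod yv
  simp [Finset.filter_singleton]

theorem GG_one (c : ℕ) (p : ℤ) (h0 : 0 ≤ p) (hp : p ≤ c) (y : Fin 1 → F) :
    GG 1 (c + 1) p y = y 0 ^ p := by
  unfold GG
  have : PS 1 (c + 1) p = {fun _ => p.toNat} := by
    ext l
    rw [mem_PS, Finset.mem_singleton]
    have e : altS l = l 0 := by simp [altS]
    rw [e]
    constructor
    · rintro ⟨_, _, h⟩
      funext i
      rw [Subsingleton.elim i 0]; omega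
    · rintro rfl
      refine ⟨fun i => by dsimp only; omega, fun i j _ => le_rfl, by dsimp only; omega⟩
  rw [this, Finset.sum_singleton]
  unfold sch altn
  obtain ⟨m, rfl⟩ := Int.eq_ofNat_of_zero_le h0
  simp

theorem image_succAbove {n : ℕ} (e : Fin (n + 1) → ι) (he : Function.Injective e)
    (k : Fin (n + 1)) :
    Finset.univ.image (fun i => e (k.succAbove i)) = (Finset.univ.image e).erase (e k) := by
  ext a
  simp only [Finset.mem_image, Finset.mem_univ, true_and, Finset.mem_erase]
  constructor
  · rintro ⟨i, rfl⟩
    exact ⟨fun h => Fin.succAbove_ne k i (he h), _, rfl⟩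
  · rintro ⟨h, j, rfl⟩
    have : j ≠ k := fun h' => h (by rw [h'])
    obtain ⟨i, rfl⟩ := Fin.exists_succAbove_eq this
    exact ⟨i, rfl⟩

theorem GG_eq_EE (hx : Gen x) (n : ℕ) : ∀ (c : ℕ) (p : ℤ) (e : Fin (n + 1) → ι),
    Function.Injective e → 0 ≤ p → p ≤ c →
    GG (n + 1) (c + 1) p (fun i => x (e i)) = EE (Finset.univ.image e) x 0 c p := by
  induction n with
  | zero =>
    intro c p e he h0 hp
    rw [GG_one c p h0 hp]
    have : Finset.univ.image e = {e 0} := by ext; simp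
    rw [this, EE_single]
  | succ n ih =>
    intro c p e he h0
    have hcard : (Finset.univ.image e).card = n + 2 := by
      rw [Finset.card_image_of_injective _ he]; simp
    have key : ∀ c : ℕ, p ≤ c → GG (n + 2) c p (fun i => x (e i)) =
        EE (Finset.univ.image e) x 0 ((c : ℤ) - 1) p → 
        GG (n + 2) (c + 1) p (fun i => x (e i)) = EE (Finset.univ.image e) x 0 c p := by
      intro c hp h
      rw [GG_rec (n + 1) c p (fun i => x (e i)) (hx.inj.comp he), h, ← eq_sub_iff_add_eq', EE_rec hx,
        Finset.sum_image (fun a _ b _ h => he h)]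
      refine Finset.sum_congr rfl fun k _ => ?_
      rw [ih c (c - p) (fun i => e (k.succAbove i)) (he.comp Fin.succAbove_right_injective)
        (by omega) (by omega), EE_symm hx, image_succAbove e he]
      congr 2
      · rw [hcard, ← zpow_natCast]; congr 1; push_cast; ring
      · rw [← image_succAbove e he, Finset.prod_image]
        intro a _ b _ h
        exact Fin.succAbove_right_injective (he h)
    have top : ∀ c : ℕ, p = c → GG (n + 2) c p (fun i => x (e i)) =
        EE (Finset.univ.image e) x 0 ((c : ℤ) - 1) p := by
      intro c hc
      have e1 := EE_top hx (Finset.univ.image e) (by omega) ((c : ℤ) - 1)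
      rw [sub_add_cancel, ← hc] at e1
      rw [hc] at e1 ⊢
      rw [e1]
      unfold GG
      have : PS (n + 2) c c = ∅ := by
        rw [Finset.eq_empty_iff_forall_notMem]
        intro l hl
        rw [mem_PS] at hl
        obtain ⟨h1, h2, h3⟩ := hl
        have := h1 0
        have := altS_bound _ l (c - 1) h2 (fun i => by have := h1 i; omega)
        omega
      rw [this, Finset.sum_empty]
    induction c with
    | zero =>
      intro hp
      refine key 0 hp (top 0 (by push_cast at hp ⊢; omega))
    | succ c ihc =>
      intro hp
      refine key (c + 1) hp ?_
      by_cases h : p ≤ c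
      · rw [ihc h]; congr 1; push_cast; ring
      · exact top (c + 1) (by push_cast at hp ⊢; omega)

end

section
variable {F ι : Type} [Field F] [LinearOrder ι] {x : ι → F}

theorem pprod_mul (A : Finset ι) (f g : ι → ι → F) :
    pprod A (fun i j => f i j * g i j) = pprod A f * pprod A g := by
  unfold pprod; simp only [Finset.prod_mul_distrib]

theorem pprod_inv (A : Finset ι) (f : ι → ι → F) :
    pprod A (fun i j => (f i j)⁻¹) = (pprod A f)⁻¹ := by
  unfold pprod; simp only [Finset.prod_inv_distrib]

theorem pprod_ne (A : Finset ι) (f : ι → ι → F) (h : ∀ i j, i < j → f i j ≠ 0) :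
    pprod A f ≠ 0 := by
  unfold pprod
  refine Finset.prod_ne_zero_iff.2 fun j _ => Finset.prod_ne_zero_iff.2 fun i hi => ?_
  exact h i j (Finset.mem_filter.1 hi).2

theorem pprod_pow (A : Finset ι) (y : ι → F) :
    pprod A (fun i j => y i * y j) = (∏ i ∈ A, y i) ^ (A.card - 1) := by
  induction A using Finset.induction_on with
  | empty => simp [pprod]
  | insert k B hk ih =>
    rw [pprod_insert B _ (fun i j => mul_comm _ _) k hk, ih, Finset.prod_insert hk,
      Finset.card_insert_of_notMem hk, Finset.prod_mul_distrib, Finset.prod_const]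
    rcases Nat.eq_zero_or_pos B.card with h | h
    · rw [Finset.card_eq_zero] at h; subst h; simp
    · obtain ⟨m, hm⟩ := Nat.exists_eq_add_of_le' h
      rw [hm]
      simp only [Nat.add_sub_cancel]
      ring

end

theorem pprod_univ_Ioi {F : Type} [Field F] {n : ℕ} (w : Fin n → Fin n → F) :
    ∏ i : Fin n, ∏ j ∈ Finset.Ioi i, w i j = pprod Finset.univ w := by
  unfold pprod
  refine Finset.prod_comm' ?_
  intro i j
  simp

theorem pprod_range {F : Type} [Field F] {n : ℕ} (w : ℕ → ℕ → F) :
    pprod (Finset.univ : Finset (Fin n)) (fun i j => w i j) =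
      ∏ j ∈ Finset.range n, ∏ i ∈ Finset.range j, w i j := by
  unfold pprod
  rw [Finset.prod_range]
  refine Finset.prod_congr rfl fun j _ => ?_
  refine Finset.prod_nbij (fun i => (i : ℕ)) ?_ ?_ ?_ ?_
  · intro i hi; simpa using hi
  · intro a _ b _ h; exact Fin.ext h
  · intro a ha
    have : a < j := by simpa using ha
    exact ⟨⟨a, by omega⟩, Finset.mem_coe.2 (Finset.mem_filter.2 ⟨Finset.mem_univ _, Fin.lt_def.2 this⟩), rfl⟩
  · intro i _; rfl

section
variable {F : Type} [Field F] {n : ℕ} {x : Fin (n + 1) → F}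

theorem hh_univ (y : Fin (n + 1) → F) (hy : Function.Injective y) (p : ℕ) :
    hh Finset.univ y (p : ℤ) = altn y (Fin.cons p (fun _ => 0)) / altn y (fun _ => 0) := by
  have := sch_succ y hy (Fin.cons p (fun _ => 0))
  unfold sch at this
  rw [this]
  unfold hh
  refine Finset.sum_congr rfl fun k _ => ?_
  have h2 := sch_zero (fun i => y (k.succAbove i)) (hy.comp Fin.succAbove_right_injective)
  unfold sch at h2
  simp only [Fin.cons_succ, Fin.cons_zero]
  rw [h2, mul_one]
  congr 1
  · rw [← zpow_natCast]; congr 1; simp; ring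
  · have : (Finset.univ : Finset (Fin (n+1))).erase k = Finset.univ.image (k.succAbove) := by
      ext i; simp [Fin.exists_succAbove_eq_iff]
    rw [this, Finset.prod_image]
    intro a _ b _ h
    exact Fin.succAbove_right_injective h

/-- exponents -/
def dd (p : ℕ) (j : ℕ) : ℤ := if j = 0 then p else -j

theorem altn_dd (y : Fin (n + 1) → F) (h0 : ∀ i, y i ≠ 0) (p : ℕ) :
    altn y (Fin.cons p (fun _ => 0)) =
      (∏ i, y i) ^ n * Matrix.det (Matrix.of fun i j : Fin (n + 1) => y i ^ dd p j) := by
  rw [← Finset.prod_pow, ← Matrix.det_mul_column]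
  unfold altn
  congr 1
  ext i j
  simp only [Matrix.of_apply]
  rw [← zpow_natCast, ← zpow_natCast, ← zpow_add₀ (h0 i)]
  congr 1
  unfold dd
  refine Fin.cases ?_ (fun j => ?_) j
  · simp; ring
  · have := j.2
    simp
    omega

/-- the theta product -/
def Th (x : Fin (n + 1) → F) : F :=
  pprod Finset.univ (fun i j => (x j + (x j)⁻¹) - (x i + (x i)⁻¹))

theorem Th_ne (hx : Gen x) : Th x ≠ 0 := by
  refine pprod_ne _ _ fun i j hij h => ?_
  have hi := hx.ne0 i
  have hj := hx.ne0 j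
  have h1 := hx.ne1 i j
  have h2 : x i ≠ x j := fun h => hij.ne (hx.inj h)
  have : (x j - x i) * (x i * x j - 1) = 0 := by
    field_simp at h
    linear_combination h
  rcases mul_eq_zero.1 this with h | h
  · exact h2 (sub_eq_zero.1 h).symm
  · exact h1 (sub_eq_zero.1 h)

theorem Th_yv (hx : Gen x) (S : Finset (Fin (n + 1))) : Th (yv x S) = Th x := by
  have : ∀ i, yv x S i + (yv x S i)⁻¹ = x i + (x i)⁻¹ := by
    intro i; unfold yv; split_ifs
    · rw [inv_inv, add_comm]
    · rfl
  unfold Th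
  simp only [this]

theorem term_eq (hx : Gen x) (S : Finset (Fin (n + 1))) (c : ℤ) (p : ℕ) :
    wgt Finset.univ x S c * hh Finset.univ (yv x S) p =
      (∏ i ∈ S, x i) ^ c *
        Matrix.det (Matrix.of fun i j : Fin (n + 1) => yv x S i ^ dd p j) / Th x := by
  have h0 := hx.yv_ne0 S
  have hi := hx.yv_inj S
  rw [hh_univ _ hi, altn_dd _ h0, altn_zero_eq, pprod_univ_Ioi]
  unfold wgt
  rw [pprod_inv]
  have e : pprod Finset.univ (fun i j => 1 - yv x S i * yv x S j) *
      pprod Finset.univ (fun i j => yv x S i - yv x S j) = (∏ i, yv x S i) ^ n * Th x := by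
    rw [← Th_yv hx S, ← pprod_mul]
    have := pprod_pow Finset.univ (yv x S)
    simp only [Finset.card_univ, Fintype.card_fin, Nat.add_sub_cancel] at this
    rw [← this]
    unfold Th
    rw [← pprod_mul]
    refine pprod_congr _ _ _ fun i _ j _ _ => ?_
    have := h0 i
    have := h0 j
    field_simp
    ring
  have n1 : pprod Finset.univ (fun i j => 1 - yv x S i * yv x S j) ≠ 0 :=
    pprod_ne _ _ fun i j h => hx.yv_mul S i j h.ne
  have n2 : pprod Finset.univ (fun i j => yv x S i - yv x S j) ≠ 0 :=
    pprod_ne _ _ fun i j h => sub_ne_zero.2 fun h' => h.ne (hi h')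
  have n3 := Th_ne hx
  rw [mul_assoc, ← div_eq_inv_mul, div_div, mul_comm (pprod _ (fun i j => yv x S i - yv x S j)), e]
  have n4 : (∏ i, yv x S i) ^ n ≠ 0 := pow_ne_zero _ (Finset.prod_ne_zero_iff.2 fun i _ => h0 i)
  field_simp

/-- symmetrised determinant -/
def DD (x : Fin (n + 1) → F) (c : ℤ) (p : ℕ) (ε : F) : F :=
  Matrix.det (Matrix.of fun i j : Fin (n + 1) => x i ^ dd p j + ε * x i ^ (c - dd p j))

theorem DD_eq (hx : Gen x) (c : ℤ) (p : ℕ) (ε : F) :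
    DD x c p ε = ∑ S : Finset (Fin (n + 1)), ε ^ S.card * ((∏ i ∈ S, x i) ^ c *
        Matrix.det (Matrix.of fun i j : Fin (n + 1) => yv x S i ^ dd p j)) := by
  unfold DD
  have := MultilinearMap.map_add_univ (Matrix.detRowAlternating (R := F) (n := Fin (n+1))).toMultilinearMap
    (fun i j => ε * x i ^ (c - dd p j)) (fun i j => x i ^ dd p j)
  have e1 : (Matrix.of fun i j : Fin (n + 1) => x i ^ dd p j + ε * x i ^ (c - dd p j)) =
    ((fun (i j : Fin (n + 1)) => ε * x i ^ (c - dd p j)) + (fun (i j : Fin (n + 1)) => x i ^ dd p j)) := by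
    ext i j; simp [add_comm]
  rw [e1]
  refine this.trans ?_
  refine Finset.sum_congr rfl fun S _ => ?_
  rw [← mul_assoc]
  have e2 : ε ^ S.card * (∏ i ∈ S, x i) ^ c = ∏ i, (if i ∈ S then ε * x i ^ c else 1) := by
    rw [Finset.prod_ite_mem, Finset.univ_inter, Finset.prod_mul_distrib, Finset.prod_const,
      Finset.prod_zpow]
  rw [e2, ← Matrix.det_mul_column]
  change Matrix.det _ = _
  congr 1
  ext i j
  simp only [Finset.piecewise, Matrix.of_apply]
  unfold yv
  split_ifs with h
  · rw [inv_zpow', mul_assoc, ← zpow_add₀ (hx.ne0 i)]; rfl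
  · rw [one_mul]

theorem EE_eval (hx : Gen x) (c : ℤ) (p : ℕ) :
    2 * EE Finset.univ x 0 c p = (DD x c p 1 + DD x c p (-1)) / Th x := by
  rw [DD_eq hx, DD_eq hx, ← Finset.sum_add_distrib, Finset.sum_div]
  unfold EE
  rw [Finset.powerset_univ, Finset.sum_filter, Finset.mul_sum]
  refine Finset.sum_congr rfl fun S _ => ?_
  rw [term_eq hx]
  split_ifs with h
  · rw [(Nat.even_iff.2 h).neg_one_pow]; ring
  · rw [(Nat.odd_iff.2 (by omega : S.card % 2 = 1)).neg_one_pow]; ring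

end

section
variable {F : Type} [Field F]

open Polynomial in
theorem poly_exists (w ε : F) (hε : ε ^ 2 = 1) : ∃ P : ℕ → F[X], (∀ i, (P i).natDegree = i) ∧
    (∀ i, (P i).Monic) ∧ ∀ u v : F, u * v = w → ∀ i,
      (u + ε * v) * (P i).eval (u ^ 2 + v ^ 2) = u ^ (2 * i + 1) + ε * v ^ (2 * i + 1) := by
  have key : ∀ i : ℕ, ∃ A B : F[X], A.natDegree = i ∧ A.Monic ∧ B.natDegree = i + 1 ∧ B.Monic ∧
      ∀ u v : F, u * v = w → 
      (u + ε * v) * A.eval (u ^ 2 + v ^ 2) = u ^ (2 * i + 1) + ε * v ^ (2 * i + 1) ∧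
      (u + ε * v) * B.eval (u ^ 2 + v ^ 2) = u ^ (2 * i + 3) + ε * v ^ (2 * i + 3) := by
    intro i
    induction i with
    | zero =>
      refine ⟨1, X - C (ε * w), by simp, monic_one, natDegree_X_sub_C _, monic_X_sub_C _, ?_⟩
      intro u v h
      rw [← h]
      simp only [eval_one, eval_sub, eval_X, eval_C]
      constructor
      · ring
      · linear_combination (-u * v ^ 2) * hε
    | succ i ih =>
      obtain ⟨A, B, hA, hAm, hB, hBm, h⟩ := ih
      have hd : (C (w ^ 2) * A).degree < (X * B).degree := by
        have : (X * B).degree = ((i + 2 : ℕ) : WithBot ℕ) := by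
          rw [degree_mul, degree_X, degree_eq_natDegree hBm.ne_zero, hB]
          norm_cast; ring
        rw [this]
        refine lt_of_le_of_lt ((degree_mul_le _ _).trans (add_le_add_left degree_C_le _)) ?_
        rw [zero_add, degree_eq_natDegree hAm.ne_zero, hA]
        exact_mod_cast (by omega : i < i + 2)
      refine ⟨B, X * B - C (w ^ 2) * A, hB, hBm, ?_, ?_, ?_⟩
      · rw [natDegree_sub_eq_left_of_natDegree_lt, natDegree_X_mul hBm.ne_zero, hB]
        rw [natDegree_X_mul hBm.ne_zero, hB]
        exact lt_of_le_of_lt (natDegree_C_mul_le _ _) (by omega)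
      · exact (monic_X.mul hBm).sub_of_left hd
      · intro u v hw
        obtain ⟨h1, h2⟩ := h u v hw
        refine ⟨by rw [h2]; ring, ?_⟩
        simp only [eval_sub, eval_mul, eval_X, eval_C]
        rw [← hw]
        linear_combination (u ^ 2 + v ^ 2) * h2 - (u * v) ^ 2 * h1
  choose A B hA hAm _ _ h using key
  exact ⟨A, hA, hAm, fun u v hw i => (h i u v hw).1⟩

theorem det_sym {N : ℕ} (w ε : F) (hε : ε ^ 2 = 1) (u v : Fin N → F) (h : ∀ j, u j * v j = w) :
    Matrix.det (Matrix.of fun i j : Fin N => u j ^ (2 * (i : ℕ) + 1) + ε * v j ^ (2 * (i : ℕ) + 1)) =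
      (∏ j, (u j + ε * v j)) * pprod Finset.univ
        (fun i j => (u j ^ 2 + v j ^ 2) - (u i ^ 2 + v i ^ 2)) := by
  obtain ⟨P, hd, hm, hP⟩ := poly_exists w ε hε
  rw [← pprod_univ_Ioi, ← Matrix.det_vandermonde (fun j => u j ^ 2 + v j ^ 2),
    Matrix.det_eval_matrixOfPolynomials_eq_det_vandermonde _ (fun i => P i) (fun i => hd i)
      (fun i => hm i), ← Matrix.det_mul_column, ← Matrix.det_transpose]
  congr 1
  ext i j
  simp only [Matrix.transpose_apply, Matrix.of_apply]
  rw [hP _ _ (h i)]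

theorem qBinom_eq (Q : F) (hQ : ∀ k : ℕ, 1 - Q ^ (k + 1) ≠ 0) (k n : ℕ) :
    qBinom Q (k + n) (k : ℤ) = ∏ j ∈ Finset.range n, (1 - Q ^ (k + j + 1)) / (1 - Q ^ (j + 1)) := by
  unfold qBinom
  rw [if_neg (by omega), Int.toNat_natCast]
  have h1 : ∏ i ∈ Finset.range k, (1 - Q ^ (((k + n : ℕ) : ℤ) - (i : ℤ))) =
      ∏ i ∈ Finset.range k, (1 - Q ^ (n + i + 1)) := by
    rw [← Finset.prod_range_reflect]
    refine Finset.prod_congr rfl fun i hi => ?_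
    rw [Finset.mem_range] at hi
    rw [← zpow_natCast]
    congr 2
    omega
  have hne : ∀ m, qFact Q m ≠ 0 := fun m => Finset.prod_ne_zero_iff.2 fun i _ => hQ i
  have h2 : qFact Q (n + k) = qFact Q n * ∏ i ∈ Finset.range k, (1 - Q ^ (n + i + 1)) := by
    unfold qFact; rw [Finset.prod_range_add]
  have h3 : qFact Q (k + n) = qFact Q k * ∏ i ∈ Finset.range n, (1 - Q ^ (k + i + 1)) := by
    unfold qFact; rw [Finset.prod_range_add]
  rw [h1, Finset.prod_div_distrib]
  change _ = _ / qFact Q n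
  rw [div_eq_div_iff (hne k) (hne n), mul_comm, ← h2, mul_comm _ (qFact Q k), ← h3, add_comm]

/-- u_j^2+v_j^2 -/
def Wf (q : F) (c p : ℕ) (j : ℕ) : F := q ^ (2 * dd p j) + q ^ (2 * ((c : ℤ) - dd p j))

/-- theta -/
def tf (q : F) (j : ℕ) : F := q ^ (2 * j + 1) + (q ^ (2 * j + 1))⁻¹

theorem W_diff0 (q : F) (h0 : q ≠ 0) (c p m : ℕ) (hp : p ≤ c) (hm : 1 ≤ m) :
    Wf q c p m - Wf q c p 0 =
      (q ^ (2 * m))⁻¹ * ((1 - (q ^ 2) ^ (p + m)) * (1 - (q ^ 2) ^ (c - p + m))) := by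
  obtain ⟨e, rfl⟩ := Nat.exists_eq_add_of_le hp
  have e1 : dd p m = -(m : ℤ) := by unfold dd; rw [if_neg (by omega)]
  have e2 : dd p 0 = p := by unfold dd; rw [if_pos rfl]
  unfold Wf
  rw [e1, e2, show p + e - p = e by omega]
  have a1 : q ^ (2 * -(m : ℤ)) = (q ^ (2 * m))⁻¹ := by
    rw [← zpow_natCast, ← zpow_neg]; congr 1; push_cast; ring
  have a2 : q ^ (2 * (((p + e : ℕ) : ℤ) - -(m : ℤ))) = q ^ (2 * (p + e + m)) := by
    rw [← zpow_natCast]; congr 1; push_cast; ring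
  have a3 : q ^ (2 * (p : ℤ)) = q ^ (2 * p) := by
    rw [← zpow_natCast]; congr 1
  have a4 : q ^ (2 * (((p + e : ℕ) : ℤ) - (p : ℤ))) = q ^ (2 * e) := by
    rw [← zpow_natCast]; congr 1; push_cast; ring
  rw [a1, a2, a3, a4]
  field_simp
  ring

theorem W_diff (q : F) (h0 : q ≠ 0) (c p m i : ℕ) (hi : 1 ≤ i) (hm : i < m) :
    Wf q c p m - Wf q c p i =
      (q ^ (2 * m))⁻¹ * ((1 - (q ^ 2) ^ (m - i)) * (1 - (q ^ 2) ^ (c + i + m))) := by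
  obtain ⟨e, rfl⟩ := Nat.exists_eq_add_of_le hm.le
  have e1 : ∀ m : ℕ, 1 ≤ m → dd p m = -(m : ℤ) := by
    intro m hm; unfold dd; rw [if_neg (by omega)]
  unfold Wf
  rw [e1 _ (by omega), e1 _ hi, show i + e - i = e by omega]
  have a1 : ∀ m : ℕ, q ^ (2 * -(m : ℤ)) = (q ^ (2 * m))⁻¹ := by
    intro m; rw [← zpow_natCast, ← zpow_neg]; congr 1; push_cast; ring
  have a2 : ∀ m : ℕ, q ^ (2 * ((c : ℤ) - -(m : ℤ))) = q ^ (2 * (c + m)) := by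
    intro m; rw [← zpow_natCast]; congr 1; push_cast; ring
  rw [a1, a2, a1, a2]
  field_simp
  ring

theorem t_diff (q : F) (h0 : q ≠ 0) (m i : ℕ) (hm : i < m) :
    tf q m - tf q i =
      (q ^ (2 * m + 1))⁻¹ * ((1 - (q ^ 2) ^ (m - i)) * (1 - (q ^ 2) ^ (i + m + 1))) := by
  obtain ⟨e, rfl⟩ := Nat.exists_eq_add_of_le hm.le
  unfold tf
  rw [show i + e - i = e by omega]
  field_simp
  ring

theorem tele (Q : F) (m : ℕ) :
    (∏ i ∈ Finset.range m, (1 - Q ^ (i + m + 1))) * (1 - Q ^ m) =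
    (∏ i ∈ Finset.range m, (1 - Q ^ (i + m))) * (1 - Q ^ (2 * m)) := by
  have h1 := Finset.prod_range_succ' (fun i => 1 - Q ^ (i + m)) m
  have h2 := Finset.prod_range_succ (fun i => 1 - Q ^ (i + m)) m
  rw [h1] at h2
  rw [show 2 * m = m + m by ring, ← h2]
  simp only [zero_add]
  congr 1
  refine Finset.prod_congr rfl fun i _ => ?_
  ring

theorem step_eval (q : F) (h0 : q ≠ 0) (hQ : ∀ k : ℕ, 1 - (q ^ 2) ^ (k + 1) ≠ 0)
    (c p n : ℕ) (hp : p ≤ c) :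
    (q ^ (n + 1))⁻¹ * ∏ i ∈ Finset.range (n + 1), (Wf q c p (n + 1) - Wf q c p i) /
        (tf q (n + 1) - tf q i) =
      (1 - (q ^ 2) ^ (p + n + 1)) / (1 - (q ^ 2) ^ (n + 1)) *
      ((1 - (q ^ 2) ^ (c - p + n + 1)) / (1 - (q ^ 2) ^ (n + 1))) /
      ((1 - (q ^ 2) ^ (c + n + 1)) / (1 - (q ^ 2) ^ (n + 1))) * (1 + (q ^ 2) ^ (n + 1))⁻¹ *
      ∏ i ∈ Finset.range (n + 1),
        ((1 - (q ^ 2) ^ (c + i + (n + 1))) / (1 - (q ^ 2) ^ (i + (n + 1)))) := by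
  set Q := q ^ 2 with hQd
  set m := n + 1 with hm
  have hQ' : ∀ k : ℕ, 1 ≤ k → 1 - Q ^ k ≠ 0 := by
    intro k hk
    obtain ⟨l, rfl⟩ := Nat.exists_eq_add_of_le' hk
    exact hQ l
  have hpc : ∀ (a : ℕ) (k : ℕ), (q ^ a)⁻¹ ^ k = ∏ _i ∈ Finset.range k, (q ^ a)⁻¹ := by
    intro a k; rw [Finset.prod_const, Finset.card_range]
  have ht : ∏ i ∈ Finset.range m, (tf q m - tf q i) =
      (q ^ (2 * m + 1))⁻¹ ^ m * ((∏ i ∈ Finset.range m, (1 - Q ^ (m - i))) *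
        ∏ i ∈ Finset.range m, (1 - Q ^ (i + m + 1))) := by
    rw [← Finset.prod_mul_distrib]
    rw [hpc, ← Finset.prod_mul_distrib]
    refine Finset.prod_congr rfl fun i hi => ?_
    exact t_diff q h0 m i (Finset.mem_range.1 hi)
  have hW : (∏ i ∈ Finset.range m, (Wf q c p m - Wf q c p i)) * ((1 - Q ^ m) * (1 - Q ^ (c + m))) =
      (q ^ (2 * m))⁻¹ ^ m * ((1 - Q ^ (p + m)) * (1 - Q ^ (c - p + m)) *
        ((∏ i ∈ Finset.range m, (1 - Q ^ (m - i))) *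
        ∏ i ∈ Finset.range m, (1 - Q ^ (c + i + m)))) := by
    rw [hm, Finset.prod_range_succ', Finset.prod_range_succ', Finset.prod_range_succ', ← hm,
      W_diff0 q h0 c p m hp (by omega)]
    have : ∏ i ∈ Finset.range n, (Wf q c p m - Wf q c p (i + 1)) =
        (q ^ (2 * m))⁻¹ ^ n * ((∏ i ∈ Finset.range n, (1 - Q ^ (m - (i + 1)))) *
        ∏ i ∈ Finset.range n, (1 - Q ^ (c + (i + 1) + m))) := by
      rw [← Finset.prod_mul_distrib]
      rw [hpc, ← Finset.prod_mul_distrib]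
      refine Finset.prod_congr rfl fun i hi => ?_
      exact W_diff q h0 c p m (i + 1) (by omega) (by have := Finset.mem_range.1 hi; omega)
    rw [this, hm, pow_succ]
    simp only [Nat.sub_zero, Nat.add_zero]
    ring
  have n1 : ∏ i ∈ Finset.range m, (1 - Q ^ (m - i)) ≠ 0 :=
    Finset.prod_ne_zero_iff.2 fun i hi => hQ' _ (by have := Finset.mem_range.1 hi; omega)
  have n2 : ∏ i ∈ Finset.range m, (1 - Q ^ (i + m + 1)) ≠ 0 :=
    Finset.prod_ne_zero_iff.2 fun i hi => hQ' _ (by omega)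
  have n3 : ∏ i ∈ Finset.range m, (1 - Q ^ (i + m)) ≠ 0 :=
    Finset.prod_ne_zero_iff.2 fun i hi => hQ' _ (by omega)
  have n4 : 1 - Q ^ m ≠ 0 := hQ' _ (by omega)
  have n5 : 1 - Q ^ (c + m) ≠ 0 := hQ' _ (by omega)
  have n6 : 1 + Q ^ m ≠ 0 := by
    intro h
    apply hQ' (2 * m) (by omega)
    linear_combination (1 - Q ^ m) * h
  have htl : (∏ i ∈ Finset.range m, (1 - Q ^ (i + m + 1))) =
    (∏ i ∈ Finset.range m, (1 - Q ^ (i + m))) * (1 + Q ^ m) := by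
    apply mul_right_cancel₀ n4
    rw [tele]; ring
  rw [Finset.prod_div_distrib, Finset.prod_div_distrib, ht, htl, eq_div_of_mul_eq (mul_ne_zero n4 n5) hW,
    show p + n + 1 = p + m by omega, show c - p + n + 1 = c - p + m by omega,
    show c + n + 1 = c + m by omega]
  have hq : (q ^ (2 * m))⁻¹ ^ m = q ^ m * (q ^ (2 * m + 1))⁻¹ ^ m := by
    rw [inv_pow, inv_pow, ← pow_mul, ← pow_mul]
    field_simp
    ring
  have hq2 : (q ^ (2 * m + 1))⁻¹ ^ m ≠ 0 := pow_ne_zero _ (inv_ne_zero (pow_ne_zero _ h0))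
  have hq3 : q ^ m ≠ 0 := pow_ne_zero _ h0
  rw [hq]
  generalize (q ^ (2 * m + 1))⁻¹ ^ m = a at *
  generalize q ^ m = a1 at *
  generalize ∏ i ∈ Finset.range m, (1 - Q ^ (m - i)) = a2 at *
  generalize ∏ i ∈ Finset.range m, (1 - Q ^ (i + m)) = a3 at *
  generalize ∏ i ∈ Finset.range m, (1 - Q ^ (c + i + m)) = a4 at *
  generalize 1 - Q ^ m = a5 at *
  generalize 1 + Q ^ m = a6 at *
  generalize 1 - Q ^ (c + m) = a7 at *
  field_simp

theorem prod_eval (q : F) (h0 : q ≠ 0) (hQ : ∀ k : ℕ, 1 - (q ^ 2) ^ (k + 1) ≠ 0)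
    (c p n : ℕ) (hp : p ≤ c) (h2 : (2 : F) ≠ 0) :
    (∏ j ∈ Finset.range n, (q ^ (j + 1))⁻¹) * (∏ j ∈ Finset.range (n + 1), ∏ i ∈ Finset.range j,
      (Wf q c p j - Wf q c p i) / (tf q j - tf q i)) =
      2 * ((qBinom (q ^ 2) (p + n) (p : ℤ) *
          qBinom (q ^ 2) (c - p + n) ((c - p : ℕ) : ℤ) /
        qBinom (q ^ 2) (c + n) (c : ℤ)) *
      (∏ i ∈ Finset.range (n + 1), (1 + q ^ (2 * i))⁻¹) *
      (∏ j ∈ Finset.range (n + 1), ∏ i ∈ Finset.range j,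
        ((1 - (q ^ 2) ^ (c + i + j)) / (1 - (q ^ 2) ^ (i + j))))) := by
  rw [qBinom_eq _ hQ, qBinom_eq _ hQ, qBinom_eq _ hQ]
  induction n with
  | zero => simp; norm_num; rw [mul_inv_cancel₀ h2]
  | succ n ih =>
    have h := step_eval q h0 hQ c p n hp
    simp only [Finset.prod_range_succ _ n, Finset.prod_range_succ _ (n + 1)] at ih h ⊢
    simp only [pow_mul] at ih h ⊢
    generalize hA : (∏ x ∈ Finset.range n, ((Wf q c p (n + 1) - Wf q c p x) / (tf q (n + 1) - tf q x))) *
      ((Wf q c p (n + 1) - Wf q c p n) / (tf q (n + 1) - tf q n)) = A at *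
    rw [mul_mul_mul_comm, mul_comm, h, ih]
    simp only [div_eq_mul_inv, mul_inv]
    ring

theorem lin_eval (q : F) (h0 : q ≠ 0) (c p n : ℕ) (ε : F) :
    ∏ j ∈ Finset.range (n + 1), (q ^ dd p j + ε * q ^ ((c : ℤ) - dd p j)) =
      q ^ p * (∏ j ∈ Finset.range n, (q ^ (j + 1))⁻¹) * ((1 + ε * q ^ ((c : ℤ) - 2 * p)) *
        ∏ i ∈ Finset.range n, (1 + ε * q ^ (c + 2 * (i + 1)))) := by
  rw [Finset.prod_range_succ']
  have e1 : q ^ dd p 0 + ε * q ^ ((c : ℤ) - dd p 0) = q ^ p * (1 + ε * q ^ ((c : ℤ) - 2 * p)) := by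
    have e2 : dd p 0 = p := by unfold dd; rw [if_pos rfl]
    rw [e2, show (c : ℤ) - p = p + (c - 2 * p) by ring, zpow_add₀ h0, zpow_natCast]; ring
  have e2 : ∀ j ∈ Finset.range n, q ^ dd p (j + 1) + ε * q ^ ((c : ℤ) - dd p (j + 1)) =
      (q ^ (j + 1))⁻¹ * (1 + ε * q ^ (c + 2 * (j + 1))) := by
    intro j _
    have e2 : dd p (j + 1) = -((j + 1 : ℕ) : ℤ) := by unfold dd; rw [if_neg (by omega)]
    have e3 : (c : ℤ) - -((j + 1 : ℕ) : ℤ) = ((c + (j + 1) : ℕ) : ℤ) := by push_cast; ring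
    rw [e2, e3, zpow_neg, zpow_natCast, zpow_natCast]
    field_simp
    ring
  rw [e1, Finset.prod_congr rfl e2, Finset.prod_mul_distrib]
  ring

theorem DD_eval (q : F) (h0 : q ≠ 0) (c p n : ℕ) (ε : F) (hε : ε ^ 2 = 1) :
    DD (fun i : Fin (n + 1) => q ^ (2 * (i : ℕ) + 1)) c p ε =
      (∏ j ∈ Finset.range (n + 1), (q ^ dd p j + ε * q ^ ((c : ℤ) - dd p j))) *
      ∏ j ∈ Finset.range (n + 1), ∏ i ∈ Finset.range j, (Wf q c p j - Wf q c p i) := by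
  rw [← pprod_range, Finset.prod_range]
  have := det_sym (N := n + 1) (q ^ (c : ℤ)) ε hε (fun j => q ^ dd p j)
    (fun j => q ^ ((c : ℤ) - dd p j)) (fun j => by rw [← zpow_add₀ h0]; congr 1; ring)
  have e : ∀ k : ℤ, (q ^ k) ^ 2 = q ^ (2 * k) := by
    intro k; rw [← zpow_natCast, ← zpow_mul, mul_comm]; rfl
  simp only [e] at this
  unfold Wf
  rw [← this]
  unfold DD
  congr 1
  ext i j
  simp only [Matrix.of_apply]
  have e : ∀ (k : ℤ) (m : ℕ), (q ^ k) ^ m = (q ^ m) ^ k := by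
    intro k m; rw [← zpow_natCast, ← zpow_mul, mul_comm, zpow_mul, zpow_natCast]
  rw [e, e]

theorem main_eval (q : F) (h0 : q ≠ 0) (hQ : ∀ k : ℕ, 1 - (q ^ 2) ^ (k + 1) ≠ 0)
    (c p n : ℕ) (hp : p ≤ c) (h2 : (2 : F) ≠ 0)
    (hx : Gen (fun i : Fin (n + 1) => q ^ (2 * (i : ℕ) + 1))) :
    EE Finset.univ (fun i : Fin (n + 1) => q ^ (2 * (i : ℕ) + 1)) 0 c p =
    q ^ p * (qBinom (q ^ 2) (p + n) (p : ℤ) *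
          qBinom (q ^ 2) (c - p + n) ((c - p : ℕ) : ℤ) /
        qBinom (q ^ 2) (c + n) (c : ℤ)) *
      (∏ i ∈ Finset.range (n + 1), (1 + q ^ (2 * i))⁻¹) *
      (∏ j ∈ Finset.range (n + 1), ∏ i ∈ Finset.range j,
        ((1 - (q ^ 2) ^ (c + i + j)) / (1 - (q ^ 2) ^ (i + j)))) *
      ((1 + q ^ ((c : ℤ) - 2 * p)) *
          (∏ i ∈ Finset.range n, (1 + q ^ (c + 2 * (i + 1)))) +
        (1 - q ^ ((c : ℤ) - 2 * p)) *
          ∏ i ∈ Finset.range n, (1 - q ^ (c + 2 * (i + 1)))) := by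
  apply mul_left_cancel₀ h2
  rw [EE_eval hx, DD_eval q h0 _ _ _ _ (by ring), DD_eval q h0 _ _ _ _ (by ring),
    lin_eval q h0, lin_eval q h0]
  have hT : Th (fun i : Fin (n + 1) => q ^ (2 * (i : ℕ) + 1)) =
    ∏ j ∈ Finset.range (n + 1), ∏ i ∈ Finset.range j, (tf q j - tf q i) := by
    rw [← pprod_range]; rfl
  have h := prod_eval q h0 hQ c p n hp h2
  rw [hT]
  simp only [Finset.prod_div_distrib] at h ⊢
  simp only [one_mul, neg_mul, ← sub_eq_add_neg]
  simp only [div_eq_mul_inv] at h ⊢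
  linear_combination (q ^ p * ((1 + q ^ ((c : ℤ) - 2 * p)) *
          (∏ i ∈ Finset.range n, (1 + q ^ (c + 2 * (i + 1)))) +
        (1 - q ^ ((c : ℤ) - 2 * p)) *
          ∏ i ∈ Finset.range n, (1 - q ^ (c + 2 * (i + 1))))) * h

end

section
variable {F : Type} [Field F]

theorem det_next {m : ℕ} (A B : Matrix (Fin (m + 1)) (Fin (m + 1)) F) (cc : Fin m → F)
    (hl : ∀ i, A i (Fin.last m) = B i (Fin.last m))
    (hs : ∀ i (j : Fin m), A i j.castSucc = B i j.castSucc + cc j * A i j.succ) :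
    A.det = B.det := by
  rw [← Matrix.det_submatrix_equiv_self Fin.revPerm A, ← Matrix.det_submatrix_equiv_self Fin.revPerm B]
  refine Matrix.det_eq_of_forall_col_eq_smul_add_pred (fun j => cc (Fin.rev j)) ?_ ?_
  · intro i
    simp [hl]
  · intro i j
    simp only [Matrix.submatrix_apply, Fin.revPerm_apply, Fin.rev_succ, Fin.rev_castSucc]
    exact hs _ _

theorem det_last {m : ℕ} (B : Matrix (Fin (m + 1)) (Fin (m + 1)) F)
    (h : ∀ j : Fin m, B (Fin.last m) j.castSucc = 0) :
    B.det = B (Fin.last m) (Fin.last m) *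
      Matrix.det (Matrix.of fun i j : Fin m => B i.castSucc j.castSucc) := by
  rw [Matrix.det_succ_row B (Fin.last m), Fin.sum_univ_castSucc, Finset.sum_eq_zero, zero_add]
  · have : ((-1 : F)) ^ ((Fin.last m : ℕ) + (Fin.last m : ℕ)) = 1 := Even.neg_one_pow ⟨_, rfl⟩
    rw [this, one_mul]
    congr 2
    ext i j
    simp [Fin.succAbove_last]
  · intro j _; rw [h]; ring

theorem geom_Icc (x z : F) (s d e : ℕ) :
    (x - z) * ∑ a ∈ Finset.Icc s (s + d), z ^ (s + d - a) * x ^ (a + e) =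
      x ^ (s + d + 1 + e) - z ^ (d + 1) * x ^ (s + e) := by
  induction d with
  | zero => simp; ring
  | succ d ih =>
    rw [← add_assoc, Finset.sum_Icc_succ_top (by omega)]
    have : ∑ a ∈ Finset.Icc s (s + d), z ^ (s + d + 1 - a) * x ^ (a + e) =
        z * ∑ a ∈ Finset.Icc s (s + d), z ^ (s + d - a) * x ^ (a + e) := by
      rw [Finset.mul_sum]
      refine Finset.sum_congr rfl fun a ha => ?_
      rw [Finset.mem_Icc] at ha
      rw [show s + d + 1 - a = (s + d - a) + 1 by omega, pow_succ]; ring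
    rw [this, mul_add, show (x - z) * (z * ∑ a ∈ Finset.Icc s (s + d), z ^ (s + d - a) * x ^ (a + e)) =
      z * ((x - z) * ∑ a ∈ Finset.Icc s (s + d), z ^ (s + d - a) * x ^ (a + e)) by ring, ih]
    simp only [Nat.sub_self, pow_zero]
    ring

theorem altn_zero_last {m : ℕ} (x : Fin (m + 1) → F) :
    altn x (fun _ => 0) = (∏ i : Fin m, (x i.castSucc - x (Fin.last m))) *
      altn (fun i => x i.castSucc) (fun _ => 0) := by
  rw [altn_zero_eq, altn_zero_eq, pprod_univ_Ioi, pprod_univ_Ioi]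
  have hp : ∀ (k : ℕ) (w : Fin k → Fin k → F), pprod Finset.univ w =
      ∏ j, ∏ i ∈ Finset.Iio j, w i j := by
    intro k w; unfold pprod
    refine Finset.prod_congr rfl fun j _ => Finset.prod_congr ?_ fun _ _ => rfl
    ext i; simp
  rw [hp, hp, Fin.prod_univ_castSucc, mul_comm]
  congr 1
  · have : Finset.Iio (Fin.last m) = Finset.univ.map Fin.castSuccEmb := by
      ext i
      simp only [Finset.mem_Iio, Finset.mem_map, Finset.mem_univ, true_and, Fin.coe_castSuccEmb]
      constructor
      · intro h; exact ⟨i.castPred h.ne, by simp⟩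
      · rintro ⟨a, rfl⟩; exact Fin.castSucc_lt_last a
    rw [this, Finset.prod_map]; rfl
  · refine Finset.prod_congr rfl fun j _ => ?_
    rw [Fin.prod_Iio_castSucc]

theorem altn_branch {m : ℕ} (x : Fin (m + 1) → F) (l : Fin (m + 1) → ℕ) (hl : Antitone l) :
    altn x l = (∏ i : Fin m, (x i.castSucc - x (Fin.last m))) *
      ∑ μ ∈ Fintype.piFinset (fun i : Fin m => Finset.Icc (l i.succ) (l i.castSucc)),
        x (Fin.last m) ^ (l (Fin.last m) + ∑ i : Fin m, (l i.castSucc - μ i)) *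
          altn (fun i => x i.castSucc) μ := by
  set z := x (Fin.last m) with hz
  have hle : ∀ j : Fin m, l j.succ ≤ l j.castSucc := fun j => hl (Fin.castSucc_lt_succ).le
  -- right side
  have hR : ∑ μ ∈ Fintype.piFinset (fun i : Fin m => Finset.Icc (l i.succ) (l i.castSucc)),
        z ^ (l (Fin.last m) + ∑ i : Fin m, (l i.castSucc - μ i)) *
          altn (fun i => x i.castSucc) μ =
      z ^ l (Fin.last m) * Matrix.det (Matrix.of fun j i : Fin m =>
        ∑ a ∈ Finset.Icc (l j.succ) (l j.castSucc), 
          z ^ (l j.castSucc - a) * x i.castSucc ^ (a + (m - 1 - (j : ℕ)))) := by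
    have := MultilinearMap.map_sum_finset
      (Matrix.detRowAlternating (R := F) (n := Fin m)).toMultilinearMap
      (fun j a => fun i => z ^ (l j.castSucc - a) * x i.castSucc ^ (a + (m - 1 - (j : ℕ))))
      (fun i : Fin m => Finset.Icc (l i.succ) (l i.castSucc))
    have e1 : (Matrix.of fun j i : Fin m =>
        ∑ a ∈ Finset.Icc (l j.succ) (l j.castSucc), 
          z ^ (l j.castSucc - a) * x i.castSucc ^ (a + (m - 1 - (j : ℕ)))) =
        (fun j : Fin m => ∑ a ∈ Finset.Icc (l j.succ) (l j.castSucc), 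
          fun i : Fin m => z ^ (l j.castSucc - a) * x i.castSucc ^ (a + (m - 1 - (j : ℕ)))) := by
      ext j i; simp
    rw [e1]
    have this' := congrArg (fun t => z ^ l (Fin.last m) * t) this
    refine Eq.trans ?_ this'.symm
    rw [Finset.mul_sum]
    refine Finset.sum_congr rfl fun μ _ => ?_
    rw [pow_add, mul_assoc]
    congr 1
    change _ = Matrix.det _
    unfold altn
    rw [← Finset.prod_pow_eq_pow_sum, ← Matrix.det_transpose, ← Matrix.det_mul_column]
    rfl
  rw [hR]
  set B : Matrix (Fin (m + 1)) (Fin (m + 1)) F := Matrix.of fun i j =>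
    Fin.lastCases (motive := fun _ => F) (x i ^ l (Fin.last m))
      (fun j : Fin m => x i ^ (l j.castSucc + (m - (j : ℕ))) -
        z ^ (l j.castSucc - l j.succ + 1) * x i ^ (l j.succ + (m - 1 - (j : ℕ)))) j with hB
  have hd : altn x l = B.det := by
    unfold altn
    refine det_next _ _ (fun j => z ^ (l j.castSucc - l j.succ + 1)) ?_ ?_
    · intro i
      simp [hB]
    · intro i j
      simp only [hB, Matrix.of_apply, Fin.lastCases_castSucc, Fin.val_castSucc, Fin.val_succ,
        Nat.add_sub_cancel]
      rw [show m - 1 - (j : ℕ) = m - (j + 1 : ℕ) by omega]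
      ring
  have hBl : ∀ j : Fin m, B (Fin.last m) j.castSucc = 0 := by
    intro j
    simp only [hB, Matrix.of_apply, Fin.lastCases_castSucc]
    rw [← hz, ← pow_add, sub_eq_zero]
    congr 1
    have := hle j
    have := j.2
    omega
  rw [hd, det_last B hBl, mul_left_comm]
  congr 1
  · simp [hB, ← hz]
  · rw [← Matrix.det_transpose, ← Matrix.det_mul_row]
    congr 1
    ext j i
    simp only [hB, Matrix.of_apply, Fin.lastCases_castSucc, Matrix.transpose_apply]
    have h1 := hle j
    obtain ⟨d, hd⟩ := Nat.exists_eq_add_of_le h1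
    rw [hd, geom_Icc, show l j.succ + d - l j.succ = d by omega]
    congr 2
    have := j.2
    omega

theorem sch_branch {m : ℕ} (x : Fin (m + 1) → F) (hx : Function.Injective x)
    (l : Fin (m + 1) → ℕ) (hl : Antitone l) :
    sch x l = 
      ∑ μ ∈ Fintype.piFinset (fun i : Fin m => Finset.Icc (l i.succ) (l i.castSucc)),
        x (Fin.last m) ^ (l (Fin.last m) + ∑ i : Fin m, (l i.castSucc - μ i)) *
          sch (fun i => x i.castSucc) μ := by
  unfold sch
  simp only [← mul_div_assoc]
  rw [← Finset.sum_div, altn_branch x l hl, altn_zero_last]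
  have h1 : (∏ i : Fin m, (x i.castSucc - x (Fin.last m))) ≠ 0 :=
    Finset.prod_ne_zero_iff.2 fun i _ => sub_ne_zero.2 fun h =>
      (Fin.castSucc_lt_last i).ne (hx h)
  rw [mul_div_mul_left _ _ h1]

end

theorem init_seg {c : ℕ} (S : Finset (Fin c)) (h : ∀ i j, i ≤ j → j ∈ S → i ∈ S) (j : Fin c) :
    j ∈ S ↔ (j : ℕ) < S.card := by
  constructor
  · intro hj
    have : Finset.Iic j ⊆ S := fun i hi => h i j (Finset.mem_Iic.1 hi) hj
    have := Finset.card_le_card this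
    rw [Fin.card_Iic] at this
    omega
  · intro hj
    by_contra hn
    have : S ⊆ Finset.Iio j := fun i hi => by
      rw [Finset.mem_Iio]
      by_contra hij
      exact hn (h j i (not_lt.1 hij) hi)
    have := Finset.card_le_card this
    rw [Fin.card_Iio] at this
    omega

theorem card_lt {c k : ℕ} (hk : k ≤ c) :
    (Finset.univ.filter (fun j : Fin c => (j : ℕ) < k)).card = k := by
  have := Finset.card_range k
  conv_rhs => rw [← this]
  refine Finset.card_nbij (fun j => (j : ℕ)) ?_ ?_ ?_
  · intro j hj; simpa using hj
  · intro a _ b _ h; exact Fin.ext h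
  · intro a ha
    have : a < k := by simpa using ha
    refine ⟨⟨a, by omega⟩, ?_, rfl⟩
    exact Finset.mem_coe.2 (Finset.mem_filter.2 ⟨Finset.mem_univ _, this⟩)

/-- tableaux of shape `l` -/
def TS (m c : ℕ) (l : Fin m → ℕ) : Finset (Fin m → Fin c → ℕ) :=
  (Fintype.piFinset fun _ : Fin m =>
          Fintype.piFinset fun _ : Fin c => Finset.range (2 * m)).filter
        (fun T => IsTab m c T ∧ (∀ i j, T i j ≠ 0 → Odd (T i j)) ∧
          ∀ i j, T i j ≠ 0 ↔ (j : ℕ) < l i)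

theorem mem_TS (m c : ℕ) (l : Fin m → ℕ) (T : Fin m → Fin c → ℕ) :
    T ∈ TS m c l ↔ (∀ i j, T i j < 2 * m) ∧ IsTab m c T ∧ (∀ i j, T i j ≠ 0 → Odd (T i j)) ∧
          ∀ i j, T i j ≠ 0 ↔ (j : ℕ) < l i := by
  simp [TS, Fintype.mem_piFinset]

/-- inner shape -/
def inS {m c : ℕ} (T : Fin (m + 1) → Fin c → ℕ) (i : Fin m) : ℕ :=
  (Finset.univ.filter (fun j : Fin c => T i.castSucc j ≠ 0 ∧ T i.castSucc j ≠ 2 * m + 1)).card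

theorem entry_ge {m c : ℕ} {l : Fin m → ℕ} {T : Fin m → Fin c → ℕ} (hT : T ∈ TS m c l)
    (k : ℕ) : ∀ (hk : k < m) (j : Fin c), T ⟨k, hk⟩ j ≠ 0 → 2 * k + 1 ≤ T ⟨k, hk⟩ j := by
  rw [mem_TS] at hT
  obtain ⟨hb, ⟨h1, h2, h3, h4⟩, ho, hs⟩ := hT
  induction k with
  | zero => intro hk j h; omega
  | succ k ih =>
    intro hk j h
    have hlt : (⟨k, by omega⟩ : Fin m) < ⟨k + 1, hk⟩ := by simp [Fin.lt_def]
    have a := h2 _ _ j hlt.le h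
    have b := h4 _ _ j hlt h
    have d := ih (by omega) j a
    obtain ⟨r, hr⟩ := ho _ _ h
    omega

theorem inS_iff {m c : ℕ} {l : Fin (m + 1) → ℕ} {T : Fin (m + 1) → Fin c → ℕ}
    (hT : T ∈ TS (m + 1) c l) (i : Fin m) (j : Fin c) :
    (T i.castSucc j ≠ 0 ∧ T i.castSucc j ≠ 2 * m + 1) ↔ (j : ℕ) < inS T i := by
  rw [mem_TS] at hT
  obtain ⟨hb, ⟨h1, h2, h3, h4⟩, ho, hs⟩ := hT
  have := init_seg (Finset.univ.filter
    (fun j : Fin c => T i.castSucc j ≠ 0 ∧ T i.castSucc j ≠ 2 * m + 1)) ?_ j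
  · rw [← inS] at this
    rw [← this]; simp
  · intro a b hab hb'
    rw [Finset.mem_filter] at hb' ⊢
    obtain ⟨_, hb1, hb2⟩ := hb'
    have := h1 _ a b hab hb1
    have h5 := h3 _ a b hab hb1
    have h6 := hb i.castSucc b
    exact ⟨Finset.mem_univ _, this, by omega⟩

theorem inS_mem {m c : ℕ} {l : Fin (m + 1) → ℕ} (hc : ∀ i, l i ≤ c)
    {T : Fin (m + 1) → Fin c → ℕ} (hT : T ∈ TS (m + 1) c l) :
    inS T ∈ Fintype.piFinset (fun i : Fin m => Finset.Icc (l i.succ) (l i.castSucc)) := by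
  have hi := inS_iff hT
  rw [mem_TS] at hT
  obtain ⟨hb, ⟨h1, h2, h3, h4⟩, ho, hs⟩ := hT
  rw [Fintype.mem_piFinset]
  intro i
  rw [Finset.mem_Icc]
  have hic : inS T i ≤ c := by
    refine (Finset.card_filter_le _ _).trans ?_
    simp
  constructor
  · by_contra h
    push Not at h
    have hj : inS T i < c := by have := hc i.succ; omega
    have a := (hs i.succ ⟨inS T i, hj⟩).2 h
    have hlt : i.castSucc < i.succ := Fin.castSucc_lt_succ
    have b := h2 _ _ _ hlt.le a
    have d := h4 _ _ _ hlt a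
    have e := hb i.succ ⟨inS T i, hj⟩
    have := (hi i ⟨inS T i, hj⟩).1 ⟨b, by omega⟩
    simp at this
  · by_contra h
    push Not at h
    have hj : l i.castSucc < c := by omega
    have a := (hi i ⟨l i.castSucc, hj⟩).2 h
    have := (hs i.castSucc ⟨l i.castSucc, hj⟩).1 a.1
    simp at this

/-- extension by zero -/
def exZ {m : ℕ} {α : Type} (z : α) (f : Fin m → α) (i : Fin (m + 1)) : α :=
  Fin.lastCases (motive := fun _ => α) z f i

@[simp] theorem exZ_last {m : ℕ} {α : Type} (z : α) (f : Fin m → α) : exZ z f (Fin.last m) = z := by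
  simp [exZ]

@[simp] theorem exZ_castSucc {m : ℕ} {α : Type} (z : α) (f : Fin m → α) (i : Fin m) :
    exZ z f i.castSucc = f i := by
  simp [exZ]

/-- remove the largest letter -/
def shr {m c : ℕ} (μ : Fin m → ℕ) (T : Fin (m + 1) → Fin c → ℕ) (i : Fin m) (j : Fin c) : ℕ :=
  if (j : ℕ) < μ i then T i.castSucc j else 0

/-- add the largest letter -/
def grw {m c : ℕ} (l : Fin (m + 1) → ℕ) (μ : Fin m → ℕ) (T : Fin m → Fin c → ℕ)
    (i : Fin (m + 1)) (j : Fin c) : ℕ :=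
  if (j : ℕ) < exZ 0 μ i then exZ (fun _ => 0) T i j else if (j : ℕ) < l i then 2 * m + 1 else 0

theorem interl {m : ℕ} {l : Fin (m + 1) → ℕ} (hl : Antitone l) {μ : Fin m → ℕ}
    (hμ : μ ∈ Fintype.piFinset (fun i : Fin m => Finset.Icc (l i.succ) (l i.castSucc))) :
    (∀ i, exZ 0 μ i ≤ l i) ∧ (∀ i i', i < i' → l i' ≤ exZ 0 μ i) ∧ Antitone μ := by
  simp only [Fintype.mem_piFinset, Finset.mem_Icc] at hμ
  have h2 : ∀ i i', i < i' → l i' ≤ exZ 0 μ i := by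
    intro i i'
    refine Fin.lastCases ?_ (fun i => ?_) i
    · intro h; exact absurd h (not_lt.2 (Fin.le_last _))
    · intro h
      rw [exZ_castSucc]
      exact (hl (Fin.castSucc_lt_iff_succ_le.1 h)).trans (hμ i).1
  refine ⟨?_, h2, ?_⟩
  · intro i
    refine Fin.lastCases ?_ (fun i => ?_) i
    · simp
    · rw [exZ_castSucc]; exact (hμ i).2
  · intro i i' h
    rcases h.eq_or_lt with h | h
    · rw [h]
    · have a := h2 i.castSucc i'.castSucc (by simpa using h)
      rw [exZ_castSucc] at a
      exact (hμ i').2.trans a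

theorem shr_mem {m c : ℕ} {l : Fin (m + 1) → ℕ} (hl : Antitone l) {μ : Fin m → ℕ}
    (hμ : μ ∈ Fintype.piFinset (fun i : Fin m => Finset.Icc (l i.succ) (l i.castSucc)))
    {T : Fin (m + 1) → Fin c → ℕ} (hT : T ∈ TS (m + 1) c l) (hTm : inS T = μ) :
    shr μ T ∈ TS m c μ := by
  have hi := inS_iff hT
  rw [hTm] at hi
  obtain ⟨-, -, hanti⟩ := interl hl hμ
  rw [mem_TS] at hT ⊢
  obtain ⟨hb, ⟨h1, h2, h3, h4⟩, ho, hs⟩ := hT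
  have hne : ∀ i j, shr μ T i j ≠ 0 ↔ (j : ℕ) < μ i := by
    intro i j
    unfold shr
    split_ifs with h
    · exact ⟨fun _ => h, fun _ => ((hi i j).2 h).1⟩
    · simp [h]
  have hv : ∀ (i : Fin m) (j : Fin c), (j : ℕ) < μ i → shr μ T i j = T i.castSucc j := by
    intro i j h; unfold shr; rw [if_pos h]
  refine ⟨?_, ⟨?_, ?_, ?_, ?_⟩, ?_, hne⟩
  · intro i j
    by_cases h : (j : ℕ) < μ i
    · rw [hv i j h]
      obtain ⟨a, b⟩ := (hi i j).2 h
      have := hb i.castSucc j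
      obtain ⟨r, hr⟩ := ho _ _ a
      omega
    · have : shr μ T i j = 0 := by
        by_contra h'
        exact h ((hne i j).1 h')
      rw [this]
      have := i.2
      omega
  · intro i j j' hj h
    rw [hne] at h ⊢
    exact lt_of_le_of_lt (Fin.le_def.1 hj) h
  · intro i i' j hii h
    rw [hne] at h ⊢
    exact lt_of_lt_of_le h (hanti hii)
  · intro i j j' hj h
    rw [hne] at h
    have h' : (j : ℕ) < μ i := lt_of_le_of_lt (Fin.le_def.1 hj) h
    rw [hv _ _ h, hv _ _ h']
    exact h3 _ _ _ hj ((hi i j').2 h).1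
  · intro i i' j hii h
    rw [hne] at h
    have h' : (j : ℕ) < μ i := lt_of_lt_of_le h (hanti hii.le)
    rw [hv _ _ h, hv _ _ h']
    exact h4 _ _ _ (by simpa using hii) ((hi i' j).2 h).1
  · intro i j h
    rw [hne] at h
    rw [hv _ _ h]
    exact ho _ _ ((hi i j).2 h).1

theorem grw_mem {m c : ℕ} {l : Fin (m + 1) → ℕ} (hl : Antitone l) (hc : ∀ i, l i ≤ c) {μ : Fin m → ℕ}
    (hμ : μ ∈ Fintype.piFinset (fun i : Fin m => Finset.Icc (l i.succ) (l i.castSucc)))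
    {T : Fin m → Fin c → ℕ} (hT : T ∈ TS m c μ) :
    grw l μ T ∈ TS (m + 1) c l ∧ inS (grw l μ T) = μ := by
  obtain ⟨hM1, hM2, hanti⟩ := interl hl hμ
  rw [mem_TS] at hT
  obtain ⟨hb, ⟨h1, h2, h3, h4⟩, ho, hs⟩ := hT
  have kne : ∀ (i : Fin (m + 1)) (j : Fin c), (j : ℕ) < exZ 0 μ i → exZ (fun _ => 0) T i j ≠ 0 := by
    intro i j
    refine Fin.lastCases ?_ (fun i => ?_) i
    · simp
    · rw [exZ_castSucc, exZ_castSucc]; exact (hs i j).2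
  have kb : ∀ i j, exZ (fun _ => 0) T i j ≤ 2 * m := by
    intro i j
    refine Fin.lastCases ?_ (fun i => ?_) i
    · simp
    · rw [exZ_castSucc]; exact (hb i j).le
  have ko : ∀ i j, exZ (fun _ => 0) T i j ≠ 0 → Odd (exZ (fun _ => 0) T i j) := by
    intro i j
    refine Fin.lastCases ?_ (fun i => ?_) i
    · simp
    · rw [exZ_castSucc]; exact ho i j
  have k3 : ∀ (i : Fin (m + 1)) (j j' : Fin c), j ≤ j' → (j' : ℕ) < exZ 0 μ i →
      exZ (fun _ => 0) T i j ≤ exZ (fun _ => 0) T i j' := by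
    intro i j j' hj
    refine Fin.lastCases ?_ (fun i => ?_) i
    · simp
    · rw [exZ_castSucc, exZ_castSucc]; intro h; exact h3 i j j' hj ((hs i j').2 h)
  have k4 : ∀ (i i' : Fin (m + 1)) (j : Fin c), i < i' → (j : ℕ) < exZ 0 μ i' →
      exZ (fun _ => 0) T i j < exZ (fun _ => 0) T i' j := by
    intro i i' j
    refine Fin.lastCases ?_ (fun i' => ?_) i'
    · simp
    · refine Fin.lastCases ?_ (fun i => ?_) i
      · intro h; exact absurd h (not_lt.2 (Fin.le_last _))
      · simp only [exZ_castSucc]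
        intro h h'; exact h4 i i' j (by simpa using h) ((hs i' j).2 h')
  have hne : ∀ i j, grw l μ T i j ≠ 0 ↔ (j : ℕ) < l i := by
    intro i j
    unfold grw
    split_ifs with h h'
    · exact ⟨fun _ => lt_of_lt_of_le h (hM1 i), fun _ => kne i j h⟩
    · simp [h']
    · simp [h']
  have hmem : grw l μ T ∈ TS (m + 1) c l := by
    rw [mem_TS]
    refine ⟨?_, ⟨?_, ?_, ?_, ?_⟩, ?_, hne⟩
    · intro i j
      have := kb i j
      unfold grw
      split_ifs <;> omega
    · intro i j j' hj h
      rw [hne] at h ⊢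
      exact lt_of_le_of_lt (Fin.le_def.1 hj) h
    · intro i i' j hii h
      rw [hne] at h ⊢
      exact lt_of_lt_of_le h (hl hii)
    · intro i j j' hj h
      rw [hne] at h
      have hj' : (j : ℕ) ≤ j' := Fin.le_def.1 hj
      have := k3 i j j' hj
      have := kb i j
      unfold grw
      split_ifs <;> first | omega | (apply this; assumption) | skip
    · intro i i' j hii h
      rw [hne] at h
      have hjM := lt_of_lt_of_le h (hM2 i i' hii)
      have := k4 i i' j hii
      have := kb i j
      unfold grw
      rw [if_pos hjM]
      split_ifs <;> first | omega | (apply this; assumption) | skip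
    · intro i j
      have := ko i j
      unfold grw
      split_ifs
      · exact this
      · intro _; exact ⟨m, rfl⟩
      · simp
  refine ⟨hmem, ?_⟩
  funext i
  have e : ∀ j : Fin c, (grw l μ T i.castSucc j ≠ 0 ∧ grw l μ T i.castSucc j ≠ 2 * m + 1) ↔
      (j : ℕ) < μ i := by
    intro j
    unfold grw
    rw [exZ_castSucc, exZ_castSucc]
    have a := hs i j
    have b := hb i j
    split_ifs with h h'
    · exact ⟨fun _ => h, fun _ => ⟨a.2 h, by omega⟩⟩
    · simp [h]
    · simp [h]
  unfold inS
  simp only [e]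
  refine card_lt ?_
  have := hM1 i.castSucc
  rw [exZ_castSucc] at this
  exact this.trans (hc _)

theorem TS_val {m c : ℕ} {l : Fin (m + 1) → ℕ} {μ : Fin m → ℕ}
    {T : Fin (m + 1) → Fin c → ℕ} (hT : T ∈ TS (m + 1) c l) (hTm : inS T = μ) :
    grw l μ (shr μ T) = T := by
  have hi := inS_iff hT
  have hge := entry_ge hT
  rw [hTm] at hi
  rw [mem_TS] at hT
  obtain ⟨hb, ⟨h1, h2, h3, h4⟩, ho, hs⟩ := hT
  funext i j
  unfold grw
  have a := hs i j
  revert a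
  refine Fin.lastCases ?_ (fun i => ?_) i
  · intro a
    rw [exZ_last, if_neg (by omega)]
    split_ifs with h
    · have b := hge m (by omega) j (a.2 h)
      have d := hb (Fin.last m) j
      have e : (⟨m, by omega⟩ : Fin (m + 1)) = Fin.last m := rfl
      rw [e] at b
      have f := ho _ _ (a.2 h)
      obtain ⟨r, hr⟩ := f
      omega
    · by_contra h'
      exact h (a.1 (fun h'' => h' h''.symm))
  · intro a
    rw [exZ_castSucc, exZ_castSucc]
    unfold shr
    have b := hi i j
    split_ifs with h h'
    · rfl
    · have := a.2 h'
      by_contra h''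
      exact h (b.1 ⟨this, fun h3 => h'' h3.symm⟩)
    · by_contra h''
      exact h' (a.1 (fun h3 => h'' h3.symm))

theorem shr_grw {m c : ℕ} (l : Fin (m + 1) → ℕ) (μ : Fin m → ℕ)
    {T : Fin m → Fin c → ℕ} (hT : T ∈ TS m c μ) : shr μ (grw l μ T) = T := by
  rw [mem_TS] at hT
  obtain ⟨hb, -, ho, hs⟩ := hT
  funext i j
  unfold shr grw
  rw [exZ_castSucc, exZ_castSucc]
  have := hs i j
  split_ifs with h
  · rfl
  · by_contra h'
    exact h (this.1 (fun h3 => h' h3.symm))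

theorem sum_grw {m c : ℕ} {l : Fin (m + 1) → ℕ} (hl : Antitone l) (hc : ∀ i, l i ≤ c) {μ : Fin m → ℕ}
    (hμ : μ ∈ Fintype.piFinset (fun i : Fin m => Finset.Icc (l i.succ) (l i.castSucc)))
    {T : Fin m → Fin c → ℕ} (hT : T ∈ TS m c μ) :
    sumTab (m + 1) c (grw l μ T) = 
      (2 * m + 1) * (l (Fin.last m) + ∑ i : Fin m, (l i.castSucc - μ i)) + sumTab m c T := by
  obtain ⟨hM1, hM2, hanti⟩ := interl hl hμ
  rw [mem_TS] at hT
  obtain ⟨hb, -, ho, hs⟩ := hT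
  have row : ∀ i, ∑ j, grw l μ T i j = (2 * m + 1) * (l i - exZ 0 μ i) +
      ∑ j, exZ (fun _ => 0) T i j := by
    intro i
    have e : ∀ j : Fin c, grw l μ T i j + (if (j : ℕ) < exZ 0 μ i then 2 * m + 1 else 0) =
        (if (j : ℕ) < l i then 2 * m + 1 else 0) + exZ (fun _ => 0) T i j := by
      intro j
      have z : ¬ (j : ℕ) < exZ 0 μ i → exZ (fun _ => 0) T i j = 0 := by
        refine Fin.lastCases ?_ (fun i => ?_) i
        · simp
        · rw [exZ_castSucc, exZ_castSucc]; intro h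
          by_contra h'
          exact h ((hs i j).1 h')
      have := hM1 i
      unfold grw
      split_ifs with h1 h2 h2
      · ring
      · omega
      · rw [z h1]
      · rw [z h1]
    have e2 := Finset.sum_congr (rfl : (Finset.univ : Finset (Fin c)) = Finset.univ) fun j _ => e j
    rw [Finset.sum_add_distrib, Finset.sum_add_distrib, ← Finset.sum_filter, ← Finset.sum_filter,
      Finset.sum_const, Finset.sum_const, card_lt (hc i), card_lt ((hM1 i).trans (hc i))] at e2
    simp only [smul_eq_mul] at e2
    have := hM1 i
    obtain ⟨d, hd⟩ := Nat.exists_eq_add_of_le this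
    rw [hd] at e2 ⊢
    rw [Nat.add_sub_cancel_left]
    linarith
  unfold sumTab
  simp only [row]
  rw [Finset.sum_add_distrib, ← Finset.mul_sum, Fin.sum_univ_castSucc, Fin.sum_univ_castSucc]
  simp only [exZ_last, exZ_castSucc, Nat.sub_zero, Finset.sum_const_zero, add_zero]
  ring

theorem TS_eq_sch {F : Type} [Field F] (q : F) (c : ℕ) (m : ℕ)
    (hq : Function.Injective (fun i : ℕ => q ^ (2 * i + 1))) :
    ∀ l : Fin m → ℕ, Antitone l → (∀ i, l i ≤ c) →
    ∑ T ∈ TS m c l, q ^ sumTab m c T = sch (fun i : Fin m => q ^ (2 * (i : ℕ) + 1)) l := by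
  induction m with
  | zero =>
    intro l _ _
    have : TS 0 c l = {fun i => i.elim0} := by
      ext T
      rw [mem_TS, Finset.mem_singleton]
      constructor
      · intro _; funext i; exact i.elim0
      · rintro rfl
        exact ⟨fun i => i.elim0, ⟨fun i => i.elim0, fun i => i.elim0, fun i => i.elim0,
          fun i => i.elim0⟩, fun i => i.elim0, fun i => i.elim0⟩
    rw [this, Finset.sum_singleton]
    simp [sumTab, sch, altn]
  | succ m ih =>
    intro l hl hc
    rw [sch_branch _ (fun a b h => Fin.ext (hq h)) l hl,
      ← Finset.sum_fiberwise_of_maps_to (fun T hT => inS_mem hc hT)]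
    refine Finset.sum_congr rfl fun μ hμ => ?_
    obtain ⟨hM1, hM2, hanti⟩ := interl hl hμ
    have := ih μ hanti (fun i => by
      have := hM1 i.castSucc
      rw [exZ_castSucc] at this
      exact this.trans (hc _))
    simp only [Fin.val_castSucc, Fin.val_last]
    rw [← this, Finset.mul_sum]
    refine Finset.sum_nbij' (shr μ) (grw l μ) ?_ ?_ ?_ ?_ ?_
    · intro T hT
      rw [Finset.mem_filter] at hT
      exact shr_mem hl hμ hT.1 hT.2
    · intro T hT
      rw [Finset.mem_filter]
      exact grw_mem hl hc hμ hT
    · intro T hT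
      rw [Finset.mem_filter] at hT
      exact TS_val hT.1 hT.2
    · intro T hT
      exact shr_grw l μ hT
    · intro T hT
      rw [Finset.mem_filter] at hT
      have h := sum_grw hl hc hμ (shr_mem hl hμ hT.1 hT.2)
      rw [TS_val hT.1 hT.2] at h
      rw [h, pow_add, pow_mul]

/-- shape -/
def shp {m c : ℕ} (T : Fin m → Fin c → ℕ) (i : Fin m) : ℕ :=
  (Finset.univ.filter (fun j : Fin c => T i j ≠ 0)).card

theorem alt_range (h : ℕ) : ∑ i ∈ Finset.range h, (-1 : ℤ) ^ i = if Odd h then 1 else 0 := by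
  rw [neg_one_geom_sum]
  by_cases hh : Even h
  · rw [if_pos hh, if_neg (Nat.not_odd_iff_even.2 hh)]
  · rw [if_neg hh, if_pos (Nat.not_even_iff_odd.1 hh)]

theorem oddCols_eq {m c : ℕ} {T : Fin m → Fin c → ℕ} (hT : IsTab m c T) :
    (oddColsTab m c T : ℤ) = altS (shp T) := by
  obtain ⟨h1, h2, h3, h4⟩ := hT
  unfold oddColsTab altS shp
  rw [Finset.card_filter]
  push_cast
  simp only [Finset.card_filter]
  push_cast
  simp only [Finset.mul_sum]
  rw [Finset.sum_comm]
  refine Finset.sum_congr rfl fun j _ => ?_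
  set S := Finset.univ.filter (fun i : Fin m => T i j ≠ 0) with hS
  have hcard : (∑ i : Fin m, if T i j ≠ 0 then (1 : ℕ) else 0) = S.card := by
    rw [hS, Finset.card_filter]
  have hm := init_seg S (by
    intro a b hab hb
    rw [hS, Finset.mem_filter] at hb ⊢
    exact ⟨Finset.mem_univ _, h2 _ _ _ hab hb.2⟩)
  have hle : S.card ≤ m := by
    have := Finset.card_le_univ S
    simpa using this
  rw [hcard]
  simp only [mul_ite, mul_one, mul_zero]
  rw [← Finset.sum_filter, ← hS, ← alt_range]
  symm
  refine Finset.sum_nbij (fun i : Fin m => (i : ℕ)) ?_ ?_ ?_ ?_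
  · intro i hi; rw [Finset.mem_range]; exact (hm i).1 hi
  · intro a _ b _ h; exact Fin.ext h
  · intro a ha
    have ha' : a < S.card := by simpa using ha
    exact ⟨⟨a, by omega⟩, Finset.mem_coe.2 ((hm _).2 ha'), rfl⟩
  · intro i _; rfl

theorem shp_iff {m c : ℕ} {T : Fin m → Fin c → ℕ} (hT : IsTab m c T) (i : Fin m) (j : Fin c) :
    T i j ≠ 0 ↔ (j : ℕ) < shp T i := by
  have := init_seg (Finset.univ.filter (fun j : Fin c => T i j ≠ 0)) (by
    intro a b hab hb
    rw [Finset.mem_filter] at hb ⊢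
    exact ⟨Finset.mem_univ _, hT.1 _ _ _ hab hb.2⟩) j
  rw [← shp] at this
  rw [← this]; simp

theorem shp_le {m c : ℕ} (T : Fin m → Fin c → ℕ) (i : Fin m) : shp T i ≤ c := by
  refine (Finset.card_filter_le _ _).trans ?_
  simp

theorem total_eq {F : Type} [Field F] (q : F) (n c p : ℕ)
    (hq : Function.Injective (fun i : ℕ => q ^ (2 * i + 1))) :
    (∑ T ∈ ((Fintype.piFinset fun _ : Fin n =>
          Fintype.piFinset fun _ : Fin c => Finset.range (2 * n)).filter
        (fun T => IsTab n c T ∧ (∀ i j, T i j ≠ 0 → Odd (T i j)) ∧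
          oddColsTab n c T = p)),
      q ^ sumTab n c T) = GG n (c + 1) p (fun i : Fin n => q ^ (2 * (i : ℕ) + 1)) := by
  unfold GG
  rw [← Finset.sum_fiberwise_of_maps_to (g := shp) (t := PS n (c + 1) p)]
  · refine Finset.sum_congr rfl fun l hl => ?_
    rw [mem_PS] at hl
    obtain ⟨hl1, hl2, hl3⟩ := hl
    rw [← TS_eq_sch q c n hq l hl2 (fun i => by have := hl1 i; omega)]
    refine Finset.sum_congr ?_ fun _ _ => rfl
    ext T
    rw [mem_TS]
    simp only [Finset.mem_filter, Fintype.mem_piFinset, Finset.mem_range]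
    constructor
    · rintro ⟨⟨a, b, d, e⟩, f⟩
      refine ⟨a, b, d, ?_⟩
      rw [← f]
      exact shp_iff b
    · rintro ⟨a, b, d, e⟩
      have f : shp T = l := by
        funext i
        unfold shp
        simp only [e]
        exact card_lt (by have := hl1 i; omega)
      refine ⟨⟨a, b, d, ?_⟩, f⟩
      have := oddCols_eq b
      rw [f, hl3] at this
      exact_mod_cast this
  · intro T hT
    simp only [Finset.mem_filter, Fintype.mem_piFinset, Finset.mem_range] at hT
    obtain ⟨a, b, d, e⟩ := hT
    rw [mem_PS]
    refine ⟨fun i => Nat.lt_succ_of_le (shp_le T i), ?_, ?_⟩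
    · intro i i' h
      refine Finset.card_le_card ?_
      intro j hj
      rw [Finset.mem_filter] at hj ⊢
      exact ⟨Finset.mem_univ _, b.2.1 _ _ _ h hj.2⟩
    · rw [← oddCols_eq b, e]

theorem qq_pow_ne_one (k : ℕ) (hk : k ≠ 0) : qq ^ k ≠ 1 := by
  intro h
  unfold qq at h
  rw [← RatFunc.algebraMap_X, ← map_pow, ← map_one (algebraMap (Polynomial ℚ) (RatFunc ℚ))] at h
  have h2 := RatFunc.algebraMap_injective ℚ h
  have h3 := congrArg Polynomial.natDegree h2
  rw [Polynomial.natDegree_X_pow, Polynomial.natDegree_one] at h3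
  exact hk h3

theorem qq_ne_zero : qq ≠ 0 := RatFunc.X_ne_zero

theorem qq_inj : Function.Injective (fun i : ℕ => qq ^ (2 * i + 1)) := by
  have key : ∀ a b : ℕ, a < b → qq ^ (2 * a + 1) ≠ qq ^ (2 * b + 1) := by
    intro a b hab h
    have e : 2 * b + 1 = (2 * a + 1) + 2 * (b - a) := by omega
    rw [e, pow_add _ (2 * a + 1)] at h
    have h1 : qq ^ (2 * a + 1) ≠ 0 := pow_ne_zero _ qq_ne_zero
    have h2 : qq ^ (2 * (b - a)) = 1 := mul_left_cancel₀ h1 (by rw [← h, mul_one])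
    exact qq_pow_ne_one _ (by omega) h2
  intro a b h
  rcases lt_trichotomy a b with h1 | h1 | h1
  · exact absurd h (key a b h1)
  · exact h1
  · exact absurd h.symm (key b a h1)

theorem qq_gen (n : ℕ) : Gen (fun i : Fin n => qq ^ (2 * (i : ℕ) + 1)) where
  two := two_ne_zero
  inj := fun a b h => Fin.ext (qq_inj h)
  ne0 := fun i => pow_ne_zero _ qq_ne_zero
  ne1 := fun i j => by
    rw [← pow_add]
    exact qq_pow_ne_one _ (by omega)

/-- generating function for tableaux with odd entries between `1`
and `2n-1`, at most `c` columns, exactly `p` of which are odd. -/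
theorem genfun_tableaux_odd_entries_odd_columns
    (n c p : ℕ) (hn : 1 ≤ n) (hp : p ≤ c) :
    (∑ T ∈ ((Fintype.piFinset fun _ : Fin n =>
          Fintype.piFinset fun _ : Fin c => Finset.range (2 * n)).filter
        (fun T => IsTab n c T ∧ (∀ i j, T i j ≠ 0 → Odd (T i j)) ∧
          oddColsTab n c T = p)),
      qq ^ sumTab n c T)
    = qq ^ p *
      (qBinom (qq ^ 2) (p + n - 1) (p : ℤ) *
          qBinom (qq ^ 2) (c - p + n - 1) ((c : ℤ) - p) /
        qBinom (qq ^ 2) (c + n - 1) (c : ℤ)) *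
      (∏ i ∈ Finset.range n, (1 + qq ^ (2 * i))⁻¹) *
      (∏ j ∈ Finset.range n, ∏ i ∈ Finset.range j,
        ((1 - (qq ^ 2) ^ (c + i + j)) / (1 - (qq ^ 2) ^ (i + j)))) *
      ((1 + qq ^ ((c : ℤ) - 2 * p)) *
          (∏ i ∈ Finset.range (n - 1), (1 + qq ^ (c + 2 * (i + 1)))) +
        (1 - qq ^ ((c : ℤ) - 2 * p)) *
          ∏ i ∈ Finset.range (n - 1), (1 - qq ^ (c + 2 * (i + 1)))) := by
  obtain ⟨m, rfl⟩ : ∃ m, n = m + 1 := ⟨n - 1, by omega⟩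
  have hG := GG_eq_EE (qq_gen (m + 1)) m c (p : ℤ) (id : Fin (m + 1) → Fin (m + 1))
    Function.injective_id (by omega) (by exact_mod_cast hp)
  rw [Finset.image_id] at hG
  have hE := main_eval qq qq_ne_zero (fun k => by
    rw [← pow_mul]
    exact sub_ne_zero.2 (qq_pow_ne_one _ (by omega)).symm) c p m hp two_ne_zero (qq_gen (m + 1))
  rw [Nat.cast_sub hp] at hE
  rw [total_eq qq (m + 1) c p qq_inj]
  exact hG.trans hE

end
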